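/- arXiv:2211.14787 — 2 statements merged into one kernel-verified Lean document; each statement's English description precedes it below -/
import Mathlib

section
/- There is no point τ₀ ∈ ℍ which is a quadratic irrationality (i.e. which satisfies Pτ₀² + Bτ₀ + C = 0 for some integers P, B, C with P ≠ 0) and which satisfies E₄(τ₀)³ = 720·Δ(τ₀). In other words, every zero of the weight 12 modular form E₄³ − 720Δ (the theta function of the Leech lattice, equal to Δ·(j − 720)) lies at a non-CM point of ℍ. -/
open scoped BigOperators

/-- `q = e^{2πiτ}`. -/
noncomputable def qq (τ : ℂ) : ℂ := Complex.exp (2 * Real.pi * Complex.I * τ)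

/-- The normalized Eisenstein series `E₄(τ) = 1 + 240·∑_{n≥1} σ₃(n)qⁿ`. -/
noncomputable def E4 (τ : ℂ) : ℂ :=
  1 + 240 * ∑' n : ℕ, (∑ d ∈ Nat.divisors (n + 1), (d : ℂ) ^ 3) * qq τ ^ (n + 1)

/-- The normalized Eisenstein series `E₆(τ) = 1 − 504·∑_{n≥1} σ₅(n)qⁿ`. -/
noncomputable def E6 (τ : ℂ) : ℂ :=
  1 - 504 * ∑' n : ℕ, (∑ d ∈ Nat.divisors (n + 1), (d : ℂ) ^ 5) * qq τ ^ (n + 1)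

/-- The discriminant function `Δ = (E₄³ − E₆²)/1728`. -/
noncomputable def Delta (τ : ℂ) : ℂ := (E4 τ ^ 3 - E6 τ ^ 2) / 1728


namespace LeechCM

open Polynomial

/-- `ℤ_(p)[β]` as a subring of `ℂ`. -/
def locRing (p : ℕ) (hp : p.Prime) (β : ℂ) : Subring ℂ where
  carrier := {x | ∃ b : ℤ, ¬ (p : ℤ) ∣ b ∧ ∃ g : ℤ[X], (b : ℂ) * x = aeval β g}
  mul_mem' := by
    rintro x y ⟨b, hb, g, hg⟩ ⟨b', hb', g', hg'⟩
    refine ⟨b * b', fun h => ?_, g * g', ?_⟩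
    · rcases (Nat.prime_iff_prime_int.mp hp).dvd_or_dvd h with h | h
      exacts [hb h, hb' h]
    · rw [map_mul, ← hg, ← hg']; push_cast; ring
  one_mem' := ⟨1, fun h => (Nat.prime_iff_prime_int.mp hp).not_dvd_one h, 1, by simp⟩
  add_mem' := by
    rintro x y ⟨b, hb, g, hg⟩ ⟨b', hb', g', hg'⟩
    refine ⟨b * b', fun h => ?_, C b' * g + C b * g', ?_⟩
    · rcases (Nat.prime_iff_prime_int.mp hp).dvd_or_dvd h with h | h
      exacts [hb h, hb' h]
    · rw [map_add, map_mul, map_mul, ← hg, ← hg']; simp; ring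
  zero_mem' := ⟨1, fun h => (Nat.prime_iff_prime_int.mp hp).not_dvd_one h, 0, by simp⟩
  neg_mem' := by
    rintro x ⟨b, hb, g, hg⟩
    exact ⟨b, hb, -g, by rw [map_neg, ← hg]; ring⟩

lemma aeval_mem_locRing (p : ℕ) (hp : p.Prime) (β : ℂ) (g : ℤ[X]) : aeval β g ∈ locRing p hp β :=
  ⟨1, fun h => (Nat.prime_iff_prime_int.mp hp).not_dvd_one h, g, by simp⟩

lemma div_mem_locRing (p : ℕ) (hp : p.Prime) (β : ℂ) {x : ℂ} (b : ℤ) (hb : ¬ (p : ℤ) ∣ b)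
    (h : (b : ℂ) * x ∈ locRing p hp β) : x ∈ locRing p hp β := by
  obtain ⟨b', hb', g, hg⟩ := h
  refine ⟨b' * b, fun h => ?_, g, ?_⟩
  · rcases (Nat.prime_iff_prime_int.mp hp).dvd_or_dvd h with h | h
    exacts [hb' h, hb h]
  · rw [← hg]; push_cast; ring

/-- some power of `β` is divisible by `p` in `ℤ_(p)[β]`. -/
def Rel (p : ℕ) (hp : p.Prime) (β : ℂ) : Prop := ∃ n : ℕ, ∃ x ∈ locRing p hp β, β ^ n = p * x

lemma psum_aux {ι : Type*} [Fintype ι] (p : ℕ) (hp : p.Prime) (α : ι → ℂ) (c : ℤ)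
    (h : ∀ k : ℕ, ∃ z : ℤ, ∑ i, α i ^ (p * k) = p * c ^ k + c ^ (p ^ 2 * k) + p ^ 2 * z) (k : ℕ)
    (hk : 0 < k) :
    ∃ z : ℤ, ∑ i, (α i ^ p - (c : ℂ) ^ p) ^ k = p ^ 2 * z := by
  have := Fact.mk hp
  have h1 : ∀ k : ℕ, ∃ z : ℤ, ∑ i, α i ^ (p * k) = (p + 1) * c ^ (p * k) + p ^ 2 * z := by
    intro k
    obtain ⟨z, hz⟩ := h k
    have h2 : (p : ℤ) ∣ (c ^ p) ^ k - c ^ k := by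
      have : (p : ℤ) ∣ c ^ p - c := by
        rw [← ZMod.intCast_zmod_eq_zero_iff_dvd]; simp
      exact this.trans (sub_dvd_pow_sub_pow _ _ _)
    have h3 := dvd_sub_pow_of_dvd_sub h2 1
    obtain ⟨u, hu⟩ := h2
    obtain ⟨v, hv⟩ := h3
    refine ⟨z - u + v, ?_⟩
    rw [hz]
    have hu' : ((c : ℂ) ^ p) ^ k - c ^ k = p * u := by exact_mod_cast hu
    have hv' : (((c : ℂ) ^ p) ^ k) ^ p - ((c : ℂ) ^ k) ^ p = p ^ 2 * v := by
      simpa using congrArg (Int.cast : ℤ → ℂ) hv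
    have e1 : (c : ℂ) ^ (p ^ 2 * k) = (((c : ℂ) ^ p) ^ k) ^ p := by
      rw [← pow_mul, ← pow_mul]; congr 1; ring
    have e2 : (c : ℂ) ^ (p * k) = ((c : ℂ) ^ p) ^ k := by rw [pow_mul]
    have e3 : (((c : ℂ) ^ k)) ^ p = ((c : ℂ) ^ p) ^ k := by rw [← pow_mul, ← pow_mul, mul_comm]
    rw [e3] at hv'
    rw [e1, e2]
    push_cast
    linear_combination -(p : ℂ) * hu' + hv'
  choose z hz using h1
  refine ⟨∑ m ∈ Finset.range (k + 1), z m * (-c ^ p) ^ (k - m) * (k.choose m), ?_⟩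
  simp only [sub_eq_add_neg]
  simp only [add_pow]
  rw [Finset.sum_comm]
  have : ∀ m ∈ Finset.range (k+1), ∑ i, (α i ^ p) ^ m * (-(c : ℂ) ^ p) ^ (k - m) * (k.choose m) =
     (p + 1) * (((c : ℂ) ^ p) ^ m * (-(c : ℂ) ^ p) ^ (k - m) * (k.choose m))
      + p ^ 2 * (z m * (-(c : ℂ) ^ p) ^ (k - m) * (k.choose m)) := by
    intro m _
    rw [← Finset.sum_mul, ← Finset.sum_mul]
    simp only [← pow_mul]
    rw [hz]
    ring
  rw [Finset.sum_congr rfl this, Finset.sum_add_distrib, ← Finset.mul_sum, ← Finset.mul_sum,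
    ← add_pow]
  simp [hk.ne']

lemma rel_of_psum {ι : Type*} [Fintype ι] (p : ℕ) (hp : p.Prime) (hcard : Fintype.card ι = p + 1)
    (α : ι → ℂ) (c : ℤ)
    (h : ∀ k : ℕ, ∃ z : ℤ, ∑ i, α i ^ (p * k) = p * c ^ k + c ^ (p ^ 2 * k) + p ^ 2 * z) (i₀ : ι) :
    Rel p hp (α i₀ - c) := by
  classical
  have hpI := Nat.prime_iff_prime_int.mp hp
  set β := α i₀ - c with hβ
  set R := locRing p hp β with hR
  set δ : ι → ℂ := fun i => α i ^ p - (c : ℂ) ^ p with hδ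
  have hs : ∀ k, 0 < k → ∃ z : ℤ, ∑ i, δ i ^ k = p ^ 2 * z := fun k hk =>
    psum_aux p hp α c h k hk
  let e : ℕ → ℂ := fun k => MvPolynomial.aeval δ (MvPolynomial.esymm ι ℤ k)
  have he0 : e 0 = 1 := by simp [e]
  have hN : ∀ k : ℕ, (k : ℂ) * e k = (-1) ^ (k + 1) *
      ∑ a ∈ Finset.HasAntidiagonal.antidiagonal k with a.1 < k, (-1) ^ a.1 * e a.1 * ∑ i, δ i ^ a.2 := by
    intro k
    have := congrArg (MvPolynomial.aeval δ) (MvPolynomial.mul_esymm_eq_sum ι ℤ k)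
    simpa [e, MvPolynomial.psum] using this
  have key : ∀ k, 1 ≤ k → k ≤ p + 1 → ∃ x ∈ R, e k = p * x := by
    intro k
    induction k using Nat.strong_induction_on with
    | _ k ih =>
    intro hk1 hk2
    have hmem : ∀ l < k, e l ∈ R := by
      intro l hl
      rcases Nat.eq_zero_or_pos l with rfl | hl0
      · rw [he0]; exact R.one_mem
      · obtain ⟨x, hx, hxe⟩ := ih l hl hl0 (by omega)
        rw [hxe]; exact R.mul_mem (natCast_mem R p) hx
    have : ∃ y ∈ R, (k : ℂ) * e k = p ^ 2 * y := by
      have h1 : ∀ a : ℕ × ℕ, ∃ y ∈ R, a ∈ ({a ∈ Finset.HasAntidiagonal.antidiagonal k | a.1 < k} : Finset _) →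
          (-1) ^ a.1 * e a.1 * ∑ i, δ i ^ a.2 = p ^ 2 * y := by
        intro a
        by_cases ha : a ∈ ({a ∈ Finset.HasAntidiagonal.antidiagonal k | a.1 < k} : Finset _)
        · simp only [Finset.mem_filter, Finset.HasAntidiagonal.mem_antidiagonal] at ha
          obtain ⟨z, hz⟩ := hs a.2 (by omega)
          refine ⟨(-1) ^ a.1 * e a.1 * z, ?_, fun _ => ?_⟩
          · exact R.mul_mem (R.mul_mem (R.pow_mem (R.neg_mem R.one_mem) _) (hmem _ ha.2))
              (intCast_mem R z)
          · rw [hz]; ring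
        · exact ⟨0, R.zero_mem, fun h => absurd h ha⟩
      choose y hy hy2 using h1
      refine ⟨(-1) ^ (k + 1) * ∑ a ∈ Finset.HasAntidiagonal.antidiagonal k with a.1 < k, y a, ?_, ?_⟩
      · exact R.mul_mem (R.pow_mem (R.neg_mem R.one_mem) _) (R.sum_mem fun a _ => hy a)
      · rw [hN, Finset.sum_congr rfl (fun a ha => hy2 a ha), ← Finset.mul_sum]; ring
    obtain ⟨y, hy, hye⟩ := this
    have hp0 : (p : ℂ) ≠ 0 := by exact_mod_cast hp.ne_zero
    refine ⟨e k / p, ?_, by field_simp⟩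
    by_cases hpk : p ∣ k
    · obtain ⟨k', rfl⟩ := hpk
      have hk' : ¬ (p : ℤ) ∣ (k' : ℤ) := by
        intro hd
        have hd : p ∣ k' := by exact_mod_cast hd
        obtain ⟨k'', rfl⟩ := hd
        have hk3 : 0 < k'' := by
          rcases Nat.eq_zero_or_pos k'' with h | h
          · subst h; simp at hk1
          · exact h
        have : p * (p * 1) ≤ p * (p * k'') := by gcongr; omega
        have := hp.two_le
        nlinarith
      refine div_mem_locRing p hp β k' hk' ?_
      have : ((k' : ℤ) : ℂ) * (e (p * k') / p) = y := by
        push_cast at hye ⊢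
        field_simp
        have : (p : ℂ) * (k' * e (p * k')) = p * (p * y) := by linear_combination hye
        exact mul_left_cancel₀ hp0 this
      rw [this]; exact hy
    · refine div_mem_locRing p hp β k (by exact_mod_cast hpk) ?_
      have : ((k : ℤ) : ℂ) * (e k / p) = p * y := by
        push_cast
        field_simp
        linear_combination hye
      rw [this]; exact R.mul_mem (natCast_mem R p) hy
  -- the polynomial relation
  have hpoly : δ i₀ ^ (p + 1) = - ∑ j ∈ Finset.range (p + 1),
      (-1) ^ (j + 1) * e (j + 1) * δ i₀ ^ (p + 1 - (j + 1)) := by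
    have h1 := Multiset.prod_X_sub_X_eq_sum_esymm (Finset.univ.val.map δ)
    have h2 := congrArg (Polynomial.eval (δ i₀)) h1
    rw [Polynomial.eval_multiset_prod] at h2
    rw [Multiset.prod_eq_zero (by
      simp only [Multiset.map_map, Multiset.mem_map]
      exact ⟨i₀, by simp, by simp⟩)] at h2
    have h3 : ∀ j, (Finset.univ.val.map δ).esymm j = e j := by
      intro j
      simp only [e]
      rw [MvPolynomial.aeval_esymm_eq_multiset_esymm]
    simp only [Multiset.card_map, Finset.card_val, Finset.card_univ, hcard, h3,
      Polynomial.eval_finsetSum] at h2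
    rw [Finset.sum_range_succ'] at h2
    simp [he0] at h2
    simp only [Nat.add_sub_add_right]
    simp only [← mul_assoc] at h2
    linear_combination -h2
  have hd1 : ∃ x ∈ R, δ i₀ ^ (p + 1) = p * x := by
    have hδR : δ i₀ ∈ R := by
      refine R.sub_mem (R.pow_mem ?_ _) (R.pow_mem (intCast_mem R c) _)
      have := aeval_mem_locRing p hp β (X + C c)
      simpa [hβ] using this
    have h1 : ∀ j, ∃ x ∈ R, j ∈ Finset.range (p + 1) → e (j + 1) = p * x := by
      intro j
      by_cases hj : j ∈ Finset.range (p + 1)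
      · obtain ⟨x, hx, hx2⟩ := key (j + 1) (by omega) (by simp at hj; omega)
        exact ⟨x, hx, fun _ => hx2⟩
      · exact ⟨0, R.zero_mem, fun h => absurd h hj⟩
    choose x hx hx2 using h1
    refine ⟨-∑ j ∈ Finset.range (p + 1), (-1) ^ (j + 1) * x j * δ i₀ ^ (p + 1 - (j + 1)), ?_, ?_⟩
    · exact R.neg_mem (R.sum_mem fun j _ => R.mul_mem (R.mul_mem
        (R.pow_mem (R.neg_mem R.one_mem) _) (hx j)) (R.pow_mem hδR _))
    · rw [hpoly, mul_neg, Finset.mul_sum]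
      congr 1
      refine Finset.sum_congr rfl fun j hj => ?_
      rw [hx2 j hj]; ring
  obtain ⟨x, hx, hxe⟩ := hd1
  obtain ⟨r, hr⟩ : ∃ r, (X + C c) ^ p = X ^ p + C c ^ p + (p : ℤ[X]) * r := by
    obtain ⟨r, hr⟩ := exists_add_pow_prime_eq hp (X : ℤ[X]) (C c)
    exact ⟨X * C c * r, by rw [hr]; ring⟩
  have hr' : δ i₀ = β ^ p + p * aeval β r := by
    have := congrArg (aeval β) hr
    simp [hβ] at this
    simp only [hδ, hβ]
    linear_combination this
  have hβR : β ∈ R := by simpa using aeval_mem_locRing p hp β X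
  have hrR := aeval_mem_locRing p hp β r
  have hdvd : ((p : R)) ∣ (⟨β, hβR⟩ : R) ^ (p * (p + 1)) := by
    have h1 : (p : R) ∣ ((⟨β, hβR⟩ : R) ^ p + p * ⟨_, hrR⟩) ^ (p + 1) := by
      refine ⟨⟨x, hx⟩, ?_⟩
      apply Subtype.ext
      push_cast
      rw [← hr', hxe]
    have h2 : (p : R) ∣ ((⟨β, hβR⟩ : R) ^ p + p * ⟨_, hrR⟩) ^ (p + 1)
        - ((⟨β, hβR⟩ : R) ^ p) ^ (p + 1) := by
      refine dvd_trans ?_ (sub_dvd_pow_sub_pow _ _ _)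
      simp
    rw [pow_mul]
    exact (dvd_sub_right h1).mp h2
  obtain ⟨w, hw⟩ := hdvd
  refine ⟨p * (p + 1), w, w.2, ?_⟩
  have := congrArg (Subtype.val) hw
  push_cast at this
  exact this

lemma dvd_of_integral (p : ℕ) (hp : p.Prime) (k : ℤ) (x : ℂ) (hx : IsIntegral ℤ x)
    (h : (k : ℂ) = p * x) : (p : ℤ) ∣ k := by
  have hp0 : (p : ℂ) ≠ 0 := by exact_mod_cast hp.ne_zero
  have hxq : x = algebraMap ℚ ℂ ((k : ℚ) / p) := by
    simp; field_simp; rw [h]; ring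
  rw [hxq, isIntegral_algebraMap_iff (algebraMap ℚ ℂ).injective] at hx
  obtain ⟨m, hm⟩ := IsIntegrallyClosed.isIntegral_iff.mp hx
  refine ⟨m, ?_⟩
  have hpq : (p : ℚ) ≠ 0 := by exact_mod_cast hp.ne_zero
  have : (k : ℚ) = p * m := by
    simp at hm; rw [hm]; field_simp
  exact_mod_cast this

lemma bad_primes (β : ℂ) (hβ : β ≠ 0) : ∃ N : ℕ, N ≠ 0 ∧ ∀ (p : ℕ) (hp : p.Prime), ¬ p ∣ N →
    ¬ Rel p hp β := by
  by_cases halg : IsAlgebraic ℤ β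
  · obtain ⟨y, hy, hIntegral⟩ := halg.exists_integral_multiple
    set θ : ℂ := y • β with hθ
    have hθ0 : θ ≠ 0 := by
      simp only [hθ, zsmul_eq_mul]; exact mul_ne_zero (by exact_mod_cast hy) hβ
    set h := minpoly ℤ θ with hh
    have h0 : h.coeff 0 ≠ 0 := by
      intro hc
      have h1 : X ∣ h := X_dvd_iff.mpr hc
      exact hθ0 (by
        obtain ⟨u, hu⟩ := h1
        have h2 : aeval θ h = 0 := minpoly.aeval ℤ θ
        have hu0 : u.Monic := (monic_X.of_mul_monic_left (hu ▸ minpoly.monic hIntegral))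
        rw [hu, map_mul, aeval_X] at h2
        rcases mul_eq_zero.mp h2 with h2 | h2
        · exact h2
        · have h3 := minpoly.min ℤ θ hu0 h2
          rw [← hh, hu, degree_mul, degree_X, degree_eq_natDegree hu0.ne_zero] at h3
          norm_cast at h3
          omega)
    refine ⟨(y * h.coeff 0).natAbs, by simp [hy, h0], ?_⟩
    rintro p hp hpN ⟨n, x, ⟨b, hb, g, hg⟩, hx⟩
    have hpI := Nat.prime_iff_prime_int.mp hp
    have hpN' : ¬ (p : ℤ) ∣ y * h.coeff 0 := by rwa [Int.natCast_dvd]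
    -- integrality of y^d g(β)
    have hgi : IsIntegral ℤ ((y : ℂ) ^ g.natDegree * aeval β g) := by
      rw [aeval_eq_sum_range, Finset.mul_sum]
      refine IsIntegral.sum _ fun i hi => ?_
      have hi' : i ≤ g.natDegree := by simp at hi; omega
      have : (y : ℂ) ^ g.natDegree * g.coeff i • β ^ i =
          ((g.coeff i * y ^ (g.natDegree - i) : ℤ) : ℂ) * θ ^ i := by
        simp only [hθ, zsmul_eq_mul, mul_pow]
        push_cast
        rw [← Nat.sub_add_cancel hi', pow_add, Nat.add_sub_cancel]
        ring
      rw [this]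
      exact (isIntegral_intCast _).mul (hIntegral.pow _)
    have hdv : ∃ w : ℂ, IsIntegral ℤ w ∧ (h.coeff 0 : ℂ) = θ * w := by
      refine ⟨-aeval θ h.divX, ?_, ?_⟩
      · refine (IsIntegral.neg ?_)
        rw [aeval_eq_sum_range]
        refine IsIntegral.sum _ fun i _ => ?_
        rw [zsmul_eq_mul]
        exact (isIntegral_intCast _).mul (hIntegral.pow _)
      · have h1 : aeval θ h = 0 := minpoly.aeval ℤ θ
        rw [← divX_mul_X_add h] at h1
        simp at h1
        linear_combination h1
    obtain ⟨w, hw, hwe⟩ := hdv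
    have := dvd_of_integral p hp (b * y ^ g.natDegree * h.coeff 0 ^ n)
      (y ^ n * ((y : ℂ) ^ g.natDegree * aeval β g) * w ^ n)
      ((((isIntegral_intCast _).pow _).mul hgi).mul (hw.pow _)) (by
        push_cast
        rw [hwe, ← hg, mul_pow, hθ, zsmul_eq_mul, mul_pow, hx]; ring)
    rcases hpI.dvd_or_dvd this with h1 | h1
    · rcases hpI.dvd_or_dvd h1 with h1 | h1
      · exact hb h1
      · exact hpN' (Dvd.dvd.mul_right (hpI.dvd_of_dvd_pow h1) _)
    · exact hpN' (Dvd.dvd.mul_left (hpI.dvd_of_dvd_pow h1) _)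
  · refine ⟨1, one_ne_zero, ?_⟩
    rintro p hp - ⟨n, x, ⟨b, hb, g, hg⟩, hx⟩
    apply halg
    refine ⟨C b * X ^ n - C (p : ℤ) * g, ?_, ?_⟩
    · intro h0
      have := congrArg (fun f => coeff f n) h0
      simp at this
      apply hb
      exact ⟨g.coeff n, by linear_combination this⟩
    · simp [hx, ← hg]; ring

end LeechCM


namespace LeechCM

open PowerSeries

/-- The power series `φ` sums to `v` at `q`. -/
def SVC (φ : PowerSeries ℂ) (q v : ℂ) : Prop := HasSum (fun n => φ.coeff n * q ^ n) v

lemma SVC.add {φ ψ : PowerSeries ℂ} {q v w : ℂ} (h : SVC φ q v) (h' : SVC ψ q w) :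
    SVC (φ + ψ) q (v + w) := by
  simpa [SVC, add_mul] using HasSum.add h h'

lemma SVC.sub {φ ψ : PowerSeries ℂ} {q v w : ℂ} (h : SVC φ q v) (h' : SVC ψ q w) :
    SVC (φ - ψ) q (v - w) := by
  simpa [SVC, sub_mul] using HasSum.sub h h'

lemma SVC.mul {φ ψ : PowerSeries ℂ} {q v w : ℂ} (h : SVC φ q v) (h' : SVC ψ q w) :
    SVC (φ * ψ) q (v * w) := by
  have h1 := h.summable.norm
  have h2 := h'.summable.norm
  have e : (fun n => (φ * ψ).coeff n * q ^ n) = fun n =>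
      ∑ kl ∈ Finset.HasAntidiagonal.antidiagonal n,
        (φ.coeff kl.1 * q ^ kl.1) * (ψ.coeff kl.2 * q ^ kl.2) := by
    ext n
    rw [coeff_mul, Finset.sum_mul]
    refine Finset.sum_congr rfl fun kl hkl => ?_
    rw [Finset.HasAntidiagonal.mem_antidiagonal] at hkl
    rw [← hkl, pow_add]; ring
  have h3 := summable_norm_sum_mul_antidiagonal_of_summable_norm h1 h2
  have h4 := tsum_mul_tsum_eq_tsum_sum_antidiagonal_of_summable_norm h1 h2
  rw [SVC, e]
  rw [← h.tsum_eq, ← h'.tsum_eq, h4]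
  exact h3.of_norm.hasSum

lemma SVC.C (a q : ℂ) : SVC (PowerSeries.C a) q a := by
  have := hasSum_single (f := fun n => (PowerSeries.C a).coeff n * q ^ n) 0 (by
    intro n hn; simp [coeff_C, hn])
  simpa [SVC] using this

lemma SVC.X (q : ℂ) : SVC (PowerSeries.X) q q := by
  have := hasSum_single (f := fun n => (PowerSeries.X : PowerSeries ℂ).coeff n * q ^ n) 1 (by
    intro n hn; simp [coeff_X, hn])
  simpa [SVC] using this

lemma SVC.one (q : ℂ) : SVC 1 q 1 := by
  simpa using SVC.C 1 q

lemma SVC.pow {φ : PowerSeries ℂ} {q v : ℂ} (h : SVC φ q v) (n : ℕ) : SVC (φ ^ n) q (v ^ n) := by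
  induction n with
  | zero => simpa using SVC.one q
  | succ n ih => rw [pow_succ, pow_succ]; exact ih.mul h

lemma SVC.expand {φ : PowerSeries ℂ} {q v : ℂ} {p : ℕ} (hp : p ≠ 0) (h : SVC φ (q ^ p) v) :
    SVC (φ.expand p hp) q v := by
  have hinj : Function.Injective (fun n : ℕ => p * n) := mul_right_injective₀ hp
  rw [SVC, ← hinj.hasSum_iff]
  · simpa [SVC, Function.comp_def, pow_mul] using h
  · intro x hx
    rw [coeff_expand_of_not_dvd, zero_mul]
    rintro ⟨y, rfl⟩
    exact hx ⟨y, rfl⟩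

/-- Integer power series version. -/
def SV (φ : PowerSeries ℤ) (q v : ℂ) : Prop := SVC (φ.map (Int.castRingHom ℂ)) q v

lemma SV.add {φ ψ : PowerSeries ℤ} {q v w : ℂ} (h : SV φ q v) (h' : SV ψ q w) :
    SV (φ + ψ) q (v + w) := by rw [SV, map_add]; exact SVC.add h h'

lemma SV.sub {φ ψ : PowerSeries ℤ} {q v w : ℂ} (h : SV φ q v) (h' : SV ψ q w) :
    SV (φ - ψ) q (v - w) := by rw [SV, map_sub]; exact SVC.sub h h'

lemma SV.mul {φ ψ : PowerSeries ℤ} {q v w : ℂ} (h : SV φ q v) (h' : SV ψ q w) :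
    SV (φ * ψ) q (v * w) := by rw [SV, map_mul]; exact SVC.mul h h'

lemma SV.pow {φ : PowerSeries ℤ} {q v : ℂ} (h : SV φ q v) (n : ℕ) : SV (φ ^ n) q (v ^ n) := by
  rw [SV, map_pow]; exact SVC.pow h n

lemma SV.C (a : ℤ) (q : ℂ) : SV (PowerSeries.C a) q a := by
  rw [SV, map_C]; exact SVC.C _ q

lemma SV.natCast (a : ℕ) (q : ℂ) : SV (a : PowerSeries ℤ) q a := by
  have := SV.C a q
  simpa using this

lemma SV.X (q : ℂ) : SV PowerSeries.X q q := by
  rw [SV, map_X]; exact SVC.X q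

lemma SV.expand {φ : PowerSeries ℤ} {q v : ℂ} {p : ℕ} (hp : p ≠ 0) (h : SV φ (q ^ p) v) :
    SV (φ.expand p hp) q v := by
  rw [SV, map_expand]; exact SVC.expand hp h

lemma SV.hasSum {φ : PowerSeries ℤ} {q v : ℂ} (h : SV φ q v) :
    HasSum (fun n => (φ.coeff n : ℂ) * q ^ n) v := by
  simpa [SV, SVC] using h

lemma SV.of_hasSum {φ : PowerSeries ℤ} {q v : ℂ}
    (h : HasSum (fun n => (φ.coeff n : ℂ) * q ^ n) v) : SV φ q v := by
  simpa [SV, SVC] using h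

lemma SV.unique {φ : PowerSeries ℤ} {q v w : ℂ} (h : SV φ q v) (h' : SV φ q w) : v = w :=
  HasSum.unique h h'

lemma SV.zero_right {φ : PowerSeries ℤ} {v : ℂ} (h : SV φ 0 v) : v = φ.coeff 0 := by
  have h1 := hasSum_single (f := fun n => (φ.coeff n : ℂ) * (0:ℂ) ^ n) 0 (by
    intro n hn; simp [hn])
  have := h.hasSum.unique h1
  simpa using this

lemma enorm_lt_one_iff (y : ℂ) : ‖y‖ₑ < 1 ↔ ‖y‖ < 1 := by
  rw [← ofReal_norm, ENNReal.ofReal_lt_one]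

/-- the analytic function defined by a power series converging on the disc -/
lemma hasFPowerSeries_of_SVC {φ : PowerSeries ℂ} {F : ℂ → ℂ}
    (h : ∀ q, ‖q‖ < 1 → SVC φ q (F q)) :
    HasFPowerSeriesOnBall F (FormalMultilinearSeries.ofScalars ℂ (fun n => φ.coeff n)) 0 1 := by
  constructor
  · refine ENNReal.le_of_forall_nnreal_lt fun r hr => ?_
    apply FormalMultilinearSeries.le_radius_of_summable_norm
    have hr' : ‖((r : ℝ) : ℂ)‖ < 1 := by
      simpa using hr
    have := (h _ hr').summable.norm
    simpa using this
  · norm_num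
  · intro y hy
    have hy' : ‖y‖ < 1 := by
      rw [← enorm_lt_one_iff]; simpa using hy
    have := h y hy'
    simpa [SVC, FormalMultilinearSeries.ofScalars_apply_eq, mul_comm] using this

lemma SVC_ext {φ ψ : PowerSeries ℂ} {F : ℂ → ℂ} (h : ∀ q, ‖q‖ < 1 → SVC φ q (F q))
    (h' : ∀ q, ‖q‖ < 1 → SVC ψ q (F q)) : φ = ψ := by
  have := (hasFPowerSeries_of_SVC h).hasFPowerSeriesAt.eq_formalMultilinearSeries
    (hasFPowerSeries_of_SVC h').hasFPowerSeriesAt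
  have := FormalMultilinearSeries.ofScalars_series_injective (𝕜 := ℂ) ℂ this
  ext n
  exact congrFun this n

lemma SV_inv {φ ψ : PowerSeries ℤ} (hφ : φ * ψ = 1) {F : ℂ → ℂ}
    (h : ∀ q, ‖q‖ < 1 → SV φ q (F q)) (hF : ∀ q, ‖q‖ < 1 → F q ≠ 0) :
    ∀ q, ‖q‖ < 1 → SV ψ q (F q)⁻¹ := by
  have hd : DifferentiableOn ℂ F (Metric.ball 0 1) := by
    have := (hasFPowerSeries_of_SVC h).differentiableOn
    refine this.mono ?_
    intro x hx
    have hx' : ‖x‖ < 1 := by simpa using hx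
    rw [← enorm_lt_one_iff] at hx'
    simpa using hx'
  have hd' : DifferentiableOn ℂ (fun q => (F q)⁻¹) (Metric.ball 0 1) :=
    hd.inv fun q hq => hF q (by simpa using hq)
  -- Taylor expansion
  obtain ⟨χ, hχ⟩ : ∃ χ : PowerSeries ℂ, ∀ q, ‖q‖ < 1 → SVC χ q (F q)⁻¹ := by
    refine ⟨PowerSeries.mk fun n => (n.factorial : ℂ)⁻¹ * iteratedDeriv n (fun q => (F q)⁻¹) 0, ?_⟩
    intro q hq
    have := Complex.hasSum_taylorSeries_on_ball (r := 1) (c := 0) hd' (z := q) (by simpa using hq)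
    simpa [SVC, mul_assoc, mul_comm, mul_left_comm] using this
  have h1 : φ.map (Int.castRingHom ℂ) * χ = 1 := by
    refine SVC_ext (F := fun q => F q * (F q)⁻¹) (fun q hq => SVC.mul (h q hq) (hχ q hq)) ?_
    intro q hq
    rw [mul_inv_cancel₀ (hF q hq)]
    exact SVC.one q
  have h2 : φ.map (Int.castRingHom ℂ) * ψ.map (Int.castRingHom ℂ) = 1 := by
    rw [← map_mul, hφ, map_one]
  have h3 : χ = ψ.map (Int.castRingHom ℂ) := by
    calc χ = (φ.map (Int.castRingHom ℂ) * ψ.map (Int.castRingHom ℂ)) * χ := by rw [h2, one_mul]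
      _ = (φ.map (Int.castRingHom ℂ) * χ) * ψ.map (Int.castRingHom ℂ) := by ring
      _ = _ := by rw [h1, one_mul]
  intro q hq
  rw [SV, ← h3]
  exact hχ q hq

/-- the `U_p` operator -/
noncomputable def Uop (p : ℕ) (φ : PowerSeries ℤ) : PowerSeries ℤ :=
  PowerSeries.mk fun n => φ.coeff (p * n)

lemma SV_Uop {p : ℕ} (hp : 0 < p) {φ : PowerSeries ℤ} {t ζ : ℂ} (hζ : IsPrimitiveRoot ζ p)
    {v : ℕ → ℂ} (h : ∀ b, SV φ (ζ ^ b * t) (v b)) :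
    SV (p * Uop p φ) (t ^ p) (∑ b ∈ Finset.range p, v b) := by
  have h1 := hasSum_sum (s := Finset.range p) fun b _ => (h b).hasSum
  have hinj : Function.Injective (fun n : ℕ => p * n) := mul_right_injective₀ hp.ne'
  rw [← hinj.hasSum_iff] at h1
  · apply SV.of_hasSum
    convert h1 using 1
    ext n
    have : ((p : PowerSeries ℤ) * Uop p φ).coeff n = p * φ.coeff (p * n) := by
      rw [← map_natCast (PowerSeries.C (R := ℤ)), coeff_C_mul]; simp [Uop]
    rw [this]
    simp only [Function.comp]
    have : ∀ b ∈ Finset.range p, (φ.coeff (p * n) : ℂ) * (ζ ^ b * t) ^ (p * n) =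
        φ.coeff (p * n) * (t ^ p) ^ n := by
      intro b _
      rw [mul_pow, ← pow_mul, ← pow_mul, show b * (p * n) = p * (b * n) by ring, pow_mul,
        hζ.pow_eq_one]; simp
    rw [Finset.sum_congr rfl this]
    simp; ring
  · intro x hx
    have hx' : ¬ p ∣ x := by
      rintro ⟨y, rfl⟩; exact hx ⟨y, rfl⟩
    have : ∀ b ∈ Finset.range p, (φ.coeff x : ℂ) * (ζ ^ b * t) ^ x =
        φ.coeff x * t ^ x * (ζ ^ x) ^ b := by
      intro b _
      rw [mul_pow, ← pow_mul, ← pow_mul, mul_comm b x]; ring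
    rw [Finset.sum_congr rfl this, ← Finset.mul_sum]
    have hne : ζ ^ x ≠ 1 := fun h => hx' (hζ.dvd_of_pow_eq_one x h)
    have := mul_geom_sum (ζ ^ x) p
    rw [← pow_mul, mul_comm x p, pow_mul, hζ.pow_eq_one, one_pow, sub_self] at this
    rw [(mul_eq_zero.mp this).resolve_left (sub_ne_zero.mpr hne), mul_zero]

lemma dvd_expand_sub_pow (p : ℕ) (hp : p.Prime) (φ : PowerSeries ℤ) :
    (p : PowerSeries ℤ) ∣ φ.expand p hp.ne_zero - φ ^ p := by
  haveI : Fact p.Prime := ⟨hp⟩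
  have h1 : (φ.expand p hp.ne_zero - φ ^ p).map (Int.castRingHom (ZMod p)) = 0 := by
    rw [map_sub, map_pow, map_expand]
    have h2 := MvPowerSeries.map_frobenius_expand (p := p) (hp := hp.ne_zero)
      (f := φ.map (Int.castRingHom (ZMod p)))
    rw [ZMod.frobenius_zmod] at h2
    rw [sub_eq_zero]
    rw [← h2]
    simp
    rfl
  have h3 : ∀ n, ∃ c, (φ.expand p hp.ne_zero - φ ^ p).coeff n = p * c := by
    intro n
    have := congrArg (PowerSeries.coeff n) h1
    rw [coeff_map] at this
    simp only [eq_intCast, map_zero] at this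
    exact (ZMod.intCast_zmod_eq_zero_iff_dvd _ p).mp this
  choose c hc using h3
  refine ⟨PowerSeries.mk c, ?_⟩
  ext n
  rw [← map_natCast (PowerSeries.C (R := ℤ)), coeff_C_mul, hc]
  simp

lemma Uop_sub (p : ℕ) (φ ψ : PowerSeries ℤ) : Uop p (φ - ψ) = Uop p φ - Uop p ψ := by
  ext n; simp [Uop]

lemma Uop_expand (p : ℕ) (hp : p ≠ 0) (φ : PowerSeries ℤ) : Uop p (φ.expand p hp) = φ := by
  ext n; simp [Uop]

lemma Uop_natCast_mul (p m : ℕ) (φ : PowerSeries ℤ) : Uop p (m * φ) = m * Uop p φ := by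
  ext n
  rw [← map_natCast (PowerSeries.C (R := ℤ)), coeff_C_mul]
  simp only [Uop, coeff_mk]
  rw [coeff_C_mul]

end LeechCM


namespace LeechCM

open PowerSeries UpperHalfPlane

lemma SV_of_mul {φ : PowerSeries ℤ} {q v : ℂ} {m : ℕ} (hm : m ≠ 0)
    (h : SV ((m : PowerSeries ℤ) * φ) q v) : SV φ q (v / m) := by
  have hm' : (m : ℂ) ≠ 0 := by exact_mod_cast hm
  have h1 := h.hasSum.div_const (m : ℂ)
  apply SV.of_hasSum
  convert! h1 using 1
  ext n
  rw [← map_natCast (PowerSeries.C (R := ℤ)), coeff_C_mul]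
  push_cast
  field_simp

lemma SV_of_X_mul {φ : PowerSeries ℤ} {q v : ℂ} (hq : q ≠ 0)
    (h : SV (PowerSeries.X * φ) q v) : SV φ q (v / q) := by
  have h0 := (hasSum_nat_add_iff' 1).mpr h.hasSum
  have h1 := h0.div_const q
  apply SV.of_hasSum
  convert! h1 using 1
  · ext n
    rw [coeff_succ_X_mul]
    field_simp
    ring
  · simp

/-- divisor power sums series -/
noncomputable def sg (k : ℕ) : PowerSeries ℤ := PowerSeries.mk fun n => ∑ d ∈ n.divisors, (d : ℤ) ^ k

/-- divisor power sums values -/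
noncomputable def sv (k : ℕ) (q : ℂ) : ℂ :=
  ∑' n : ℕ, (∑ d ∈ Nat.divisors (n + 1), (d : ℂ) ^ k) * q ^ (n + 1)

lemma SV_sg (k : ℕ) {q : ℂ} (hq : ‖q‖ < 1) : SV (sg k) q (sv k q) := by
  have hs : Summable fun n : ℕ => ((∑ d ∈ n.divisors, (d : ℂ) ^ k)) * q ^ n := by
    apply Summable.of_norm_bounded (summable_norm_pow_mul_geometric_of_norm_lt_one (k + 1) hq)
    intro n
    have h1 : (∑ d ∈ n.divisors, (d : ℂ) ^ k) = ((ArithmeticFunction.sigma k n : ℕ) : ℂ) := by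
      simp [ArithmeticFunction.sigma_apply]
    rw [h1]
    simp only [norm_mul, Complex.norm_natCast, norm_pow]
    gcongr
    exact_mod_cast (ArithmeticFunction.sigma_le_pow_succ k n)
  have h2 := hs.hasSum
  apply SV.of_hasSum
  have h3 := hs.tsum_eq_zero_add
  simp only [Nat.divisors_zero, Finset.sum_empty, zero_mul, zero_add] at h3
  rw [h3] at h2
  simpa [sg, sv] using h2

noncomputable def e4 : PowerSeries ℤ := 1 + (240 : ℕ) * sg 3
noncomputable def e6 : PowerSeries ℤ := 1 - (504 : ℕ) * sg 5
noncomputable def f4 (q : ℂ) : ℂ := 1 + 240 * sv 3 q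
noncomputable def f6 (q : ℂ) : ℂ := 1 - 504 * sv 5 q
noncomputable def fD (q : ℂ) : ℂ := (f4 q ^ 3 - f6 q ^ 2) / 1728

lemma SV_one (q : ℂ) : SV 1 q 1 := by simpa using SV.natCast 1 q

lemma SV_e4 {q : ℂ} (hq : ‖q‖ < 1) : SV e4 q (f4 q) := by
  have := (SV_one q).add ((SV.natCast 240 q).mul (SV_sg 3 hq))
  simpa [e4, f4] using this

lemma SV_e6 {q : ℂ} (hq : ‖q‖ < 1) : SV e6 q (f6 q) := by
  have := (SV_one q).sub ((SV.natCast 504 q).mul (SV_sg 5 hq))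
  simpa [e6, f6] using this

noncomputable def c12 : PowerSeries ℤ :=
  PowerSeries.mk fun n => (∑ d ∈ n.divisors, (5 * (d : ℤ) ^ 3 + 7 * (d : ℤ) ^ 5)) / 12

lemma dvd_twelve (d : ℤ) : (12 : ℤ) ∣ 5 * d ^ 3 + 7 * d ^ 5 := by
  have : ∀ x : ZMod 12, 5 * x ^ 3 + 7 * x ^ 5 = 0 := by decide
  apply (ZMod.intCast_zmod_eq_zero_iff_dvd _ 12).mp
  push_cast
  exact this _

lemma c12_eq : 12 * c12 = 5 * sg 3 + 7 * sg 5 := by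
  ext n
  rw [show (12 : PowerSeries ℤ) = PowerSeries.C 12 by simp, show (5 : PowerSeries ℤ) = PowerSeries.C 5 by simp,
    show (7 : PowerSeries ℤ) = PowerSeries.C 7 by simp, map_add, coeff_C_mul, coeff_C_mul, coeff_C_mul]
  simp only [c12, sg, coeff_mk]
  rw [Int.mul_ediv_cancel' (Finset.dvd_sum fun (d : ℕ) _ => dvd_twelve (d : ℤ)), Finset.sum_add_distrib,
    Finset.mul_sum, Finset.mul_sum]

lemma sg_coeff_zero (k : ℕ) : (sg k).coeff 0 = 0 := by simp [sg]

noncomputable def dl : PowerSeries ℤ :=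
  c12 + sg 3 * (100 * sg 3 + 8000 * sg 3 ^ 2) - sg 5 * (147 * sg 5)

lemma dl_eq : ((1728 : ℕ) : PowerSeries ℤ) * dl = e4 ^ 3 - e6 ^ 2 := by
  simp only [dl, e4, e6]
  push_cast
  linear_combination 144 * c12_eq

lemma dl_coeff_zero : dl.coeff 0 = 0 := by
  simp [dl, c12, sg]

lemma dl_coeff_one : dl.coeff 1 = 1 := by
  have : Finset.HasAntidiagonal.antidiagonal 1 = ({(0, 1), (1, 0)} : Finset (ℕ × ℕ)) := by decide
  simp [dl, c12, sg, coeff_mul, this]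

lemma exists_dl' : ∃ d w : PowerSeries ℤ, dl = PowerSeries.X * d ∧ d * w = 1 := by
  obtain ⟨d, hd⟩ := PowerSeries.X_dvd_iff.mpr (show constantCoeff dl = 0 by
    rw [← coeff_zero_eq_constantCoeff_apply]; exact dl_coeff_zero)
  have h1 : d.coeff 0 = 1 := by
    rw [← coeff_succ_X_mul, ← hd]; exact dl_coeff_one
  have : IsUnit d := by
    rw [PowerSeries.isUnit_iff_constantCoeff, ← coeff_zero_eq_constantCoeff_apply, h1]
    exact isUnit_one
  obtain ⟨w, hw⟩ := this.exists_right_inv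
  exact ⟨d, w, hd, hw⟩

lemma norm_qq_lt {z : ℂ} (hz : 0 < z.im) : ‖qq z‖ < 1 := by
  rw [qq, Complex.norm_exp]
  rw [Real.exp_lt_one_iff]
  simp
  positivity

lemma qq_ne_zero (z : ℂ) : qq z ≠ 0 := Complex.exp_ne_zero _

lemma exists_qq {q : ℂ} (h0 : q ≠ 0) (hq : ‖q‖ < 1) : ∃ z : ℂ, 0 < z.im ∧ qq z = q := by
  refine ⟨Complex.log q / (2 * Real.pi * Complex.I), ?_, ?_⟩
  · have : Complex.log q / (2 * Real.pi * Complex.I) =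
        ((2 * Real.pi : ℝ) : ℂ)⁻¹ * (-Complex.I * Complex.log q) := by
      have : (Real.pi : ℂ) ≠ 0 := by exact_mod_cast Real.pi_ne_zero
      have := Complex.I_ne_zero
      push_cast
      field_simp
      simp
    rw [this, ← Complex.ofReal_inv, Complex.im_ofReal_mul]
    have h2 : Real.log ‖q‖ < 0 := Real.log_neg (norm_pos_iff.mpr h0) hq
    simp [Complex.log_re]
    have := Real.pi_pos
    have : 0 < Real.pi⁻¹ * 2⁻¹ := by positivity
    nlinarith
  · rw [qq, mul_div_cancel₀, Complex.exp_log h0]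
    simp [Real.pi_ne_zero]

lemma E4_eq (z : ℍ) : E4 z = ModularForm.E₄ z := by
  have h := EisensteinSeries.q_expansion_bernoulli (k := 4) (by norm_num) (by decide) z
  have hb : bernoulli 4 = -1/30 := by decide +kernel
  rw [h, hb]
  simp_rw [zpow_natCast]
  rw [tsum_pnat_eq_tsum_succ (f := fun n ↦ (ArithmeticFunction.sigma (4 - 1) n : ℂ) * Complex.exp (2 * Real.pi * Complex.I * z) ^ n)]
  simp only [E4, qq, ArithmeticFunction.sigma_apply]
  push_cast
  norm_num

lemma E6_eq (z : ℍ) : E6 z = ModularForm.E₆ z := by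
  have h := EisensteinSeries.q_expansion_bernoulli (k := 6) (by norm_num) (by decide) z
  have hb : bernoulli 6 = 1/42 := by decide +kernel
  rw [h, hb]
  simp_rw [zpow_natCast]
  rw [tsum_pnat_eq_tsum_succ (f := fun n ↦ (ArithmeticFunction.sigma (6 - 1) n : ℂ) * Complex.exp (2 * Real.pi * Complex.I * z) ^ n)]
  simp only [E6, qq, ArithmeticFunction.sigma_apply]
  push_cast
  norm_num

lemma Delta_eq (z : ℍ) : Delta z = ModularForm.discriminant z := by
  rw [ModularForm.discriminant_eq_E₄_cube_sub_E₆_sq, Delta, E4_eq, E6_eq]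

lemma Delta_ne_zero {z : ℂ} (hz : 0 < z.im) : Delta z ≠ 0 := by
  have := Delta_eq ⟨z, hz⟩
  intro h
  exact ModularForm.discriminant_ne_zero ⟨z, hz⟩ (this ▸ h)

/-- the `j`-function -/
noncomputable def jf (z : ℂ) : ℂ := E4 z ^ 3 / Delta z

lemma exists_u : ∃ u : PowerSeries ℤ, u.coeff 0 = 1 ∧
    (∀ z : ℂ, 0 < z.im → SV u (qq z) (jf z * qq z)) ∧
    (∀ q : ℂ, ‖q‖ < 1 → ∃ v, SV u q v) := by
  obtain ⟨d, w, hd, hw⟩ := exists_dl'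
  have hD : ∀ q : ℂ, ‖q‖ < 1 → SV dl q (fD q) := by
    intro q hq
    have := ((SV_e4 hq).pow 3).sub ((SV_e6 hq).pow 2)
    rw [← dl_eq] at this
    have := SV_of_mul (by norm_num) this
    simpa [fD] using this
  have hd0 : d.coeff 0 = 1 := by
    rw [← coeff_succ_X_mul, ← hd]; exact dl_coeff_one
  let g : ℂ → ℂ := fun q => if q = 0 then 1 else fD q / q
  have hg : ∀ q : ℂ, ‖q‖ < 1 → SV d q (g q) := by
    intro q hq
    by_cases h0 : q = 0
    · subst h0
      apply SV.of_hasSum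
      have h1 := hasSum_single (f := fun n => (d.coeff n : ℂ) * (0:ℂ) ^ n) 0 (by
        intro n hn; simp [hn])
      rw [hd0] at h1
      simpa [g] using h1
    · have := hD q hq
      rw [hd] at this
      simpa [g, h0] using SV_of_X_mul h0 this
  have hg0 : ∀ q : ℂ, ‖q‖ < 1 → g q ≠ 0 := by
    intro q hq
    by_cases h0 : q = 0
    · simp [g, h0]
    · simp only [g, h0, if_false]
      obtain ⟨z, hz, rfl⟩ := exists_qq h0 hq
      exact div_ne_zero (Delta_ne_zero hz) h0
  have hwv := SV_inv hw hg hg0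
  refine ⟨e4 ^ 3 * w, ?_, ?_, ?_⟩
  · have h1 : w.coeff 0 = 1 := by
      have := congrArg (PowerSeries.coeff 0) hw
      rw [coeff_zero_eq_constantCoeff_apply, map_mul, ← coeff_zero_eq_constantCoeff_apply,
        ← coeff_zero_eq_constantCoeff_apply, hd0, one_mul] at this
      simpa using this
    have h2 : e4.coeff 0 = 1 := by
      simp [e4, sg]
    rw [coeff_zero_eq_constantCoeff_apply] at *
    rw [map_mul, map_pow, h1, h2]; norm_num
  · intro z hz
    have := ((SV_e4 (norm_qq_lt hz)).pow 3).mul (hwv _ (norm_qq_lt hz))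
    convert this using 1
    simp only [g, qq_ne_zero, if_false]
    rw [inv_div, jf]
    change E4 z ^ 3 / Delta z * qq z = E4 z ^ 3 * (qq z / Delta z)
    ring
  · intro q hq
    exact ⟨_, ((SV_e4 hq).pow 3).mul (hwv _ hq)⟩

end LeechCM


namespace LeechCM

open PowerSeries UpperHalfPlane ModularGroup CongruenceSubgroup Matrix.SpecialLinearGroup
open scoped MatrixGroups Manifold ModularForm

lemma E4_smul (γ : SL(2, ℤ)) (z : ℍ) : E4 ((γ • z : ℍ) : ℂ) = denom γ z ^ 4 * E4 z := by
  rw [E4_eq, E4_eq]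
  have h := SlashInvariantForm.slash_action_eqn' (k := 4) (Γ := 𝒮ℒ) ModularForm.E₄ (γ := (γ : GL (Fin 2) ℝ)) ⟨γ, rfl⟩ z
  exact_mod_cast h

lemma E6_smul (γ : SL(2, ℤ)) (z : ℍ) : E6 ((γ • z : ℍ) : ℂ) = denom γ z ^ 6 * E6 z := by
  rw [E6_eq, E6_eq]
  have h := SlashInvariantForm.slash_action_eqn' (k := 6) (Γ := 𝒮ℒ) ModularForm.E₆ (γ := (γ : GL (Fin 2) ℝ)) ⟨γ, rfl⟩ z
  exact_mod_cast h

lemma jf_smul (γ : SL(2, ℤ)) (z : ℍ) : jf ((γ • z : ℍ) : ℂ) = jf z := by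
  have h0 : denom γ z ≠ 0 := denom_ne_zero _ _
  have h1 : Delta ((γ • z : ℍ) : ℂ) = denom γ z ^ 12 * Delta z := by
    rw [Delta, Delta, E4_smul, E6_smul]; ring
  rw [jf, jf, h1, E4_smul]
  rw [show (denom γ z ^ 4 * E4 z) ^ 3 = denom γ z ^ 12 * E4 z ^ 3 by ring,
    mul_div_mul_left _ _ (pow_ne_zero _ h0)]

/-- matrix in SL2 from entries -/
lemma exists_smul {a b c d : ℤ} (h : a * d - b * c = 1) (z : ℍ) :
    ∃ γ : SL(2, ℤ), ((γ • z : ℍ) : ℂ) = (a * z + b) / (c * z + d) := by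
  let γ : SL(2, ℤ) := ⟨!![a, b; c, d], by rw [Matrix.det_fin_two_of]; exact h⟩
  refine ⟨γ, ?_⟩
  rw [coe_specialLinearGroup_apply]
  simp [γ]

lemma jf_moeb {a b c d : ℤ} (h : a * d - b * c = 1) {z : ℂ} (hz : 0 < z.im) :
    0 < ((a * z + b) / (c * z + d)).im ∧ jf ((a * z + b) / (c * z + d)) = jf z := by
  obtain ⟨γ, hγ⟩ := exists_smul h ⟨z, hz⟩
  change _ = (a * z + b) / (c * z + d) at hγ
  rw [← hγ]
  exact ⟨(γ • (⟨z, hz⟩ : ℍ)).im_pos, jf_smul γ ⟨z, hz⟩⟩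

lemma qq_add_one (z : ℂ) : qq (z + 1) = qq z := by
  rw [qq, qq, mul_add, Complex.exp_add]
  simp [Complex.exp_two_pi_mul_I]

lemma jf_add_one (z : ℂ) : jf (z + 1) = jf z := by
  simp only [jf, Delta, E4, E6, qq_add_one]

lemma differentiableOn_of_SV {φ : PowerSeries ℤ} {F : ℂ → ℂ}
    (h : ∀ q, ‖q‖ < 1 → SV φ q (F q)) :
    DifferentiableOn ℂ F (Metric.ball 0 1) := by
  have := (hasFPowerSeries_of_SVC h).differentiableOn
  refine this.mono ?_
  intro x hx
  have hx' : ‖x‖ < 1 := by simpa using hx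
  rw [← enorm_lt_one_iff] at hx'
  simpa using hx'

lemma differentiable_qq : Differentiable ℂ qq := by
  unfold qq; fun_prop

lemma differentiableOn_comp_qq {F : ℂ → ℂ} (h : DifferentiableOn ℂ F (Metric.ball 0 1)) :
    DifferentiableOn ℂ (fun z => F (qq z)) {z | 0 < z.im} :=
  h.comp differentiable_qq.differentiableOn fun z hz => by simpa using norm_qq_lt hz

lemma differentiableOn_E4 : DifferentiableOn ℂ E4 {z | 0 < z.im} :=
  differentiableOn_comp_qq (differentiableOn_of_SV fun _ hq => SV_e4 hq)

lemma differentiableOn_E6 : DifferentiableOn ℂ E6 {z | 0 < z.im} :=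
  differentiableOn_comp_qq (differentiableOn_of_SV fun _ hq => SV_e6 hq)

lemma differentiableOn_jf : DifferentiableOn ℂ jf {z | 0 < z.im} := by
  refine DifferentiableOn.div (differentiableOn_E4.pow 3) ?_ fun z hz => Delta_ne_zero hz
  exact ((differentiableOn_E4.pow 3).sub (differentiableOn_E6.pow 2)).div_const _

lemma const_of_bounded {G : ℂ → ℂ} (hG : DifferentiableOn ℂ G {z | 0 < z.im})
    (hT : ∀ z : ℂ, 0 < z.im → G (z + 1) = G z) (hS : ∀ z : ℂ, 0 < z.im → G (-1 / z) = G z)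
    {K : ℝ} (hb : ∀ z : ℂ, 1 ≤ z.im → ‖G z‖ ≤ K) :
    ∃ c, ∀ z : ℂ, 0 < z.im → G z = c := by
  let g : ℍ → ℂ := fun z => G z
  have hgT : g ∣[(0 : ℤ)] ModularGroup.T = g := by
    ext z
    rw [ModularForm.SL_slash_apply, modular_T_smul]
    simp only [neg_zero, zpow_zero, mul_one, g]
    rw [← hT z z.im_pos]
    congr 1
    simp [add_comm]
  have hgS : g ∣[(0 : ℤ)] ModularGroup.S = g := by
    ext z
    rw [ModularForm.SL_slash_apply, modular_S_smul]
    simp only [neg_zero, zpow_zero, mul_one, g]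
    rw [← hS z z.im_pos]
    congr 1
    simp [neg_div]
  let f : ModularForm 𝒮ℒ 0 :=
    { toFun := g
      slash_action_eq' := by
        rintro A ⟨A, rfl⟩
        exact SlashInvariantForm.slash_action_generators_SL2Z hgS hgT A
      holo' := by
        rw [UpperHalfPlane.mdifferentiable_iff]
        refine hG.congr fun z hz => ?_
        simp [g, ofComplex_apply_of_im_pos hz]
      bdd_at_cusps' := by
        intro c hc
        rw [Subgroup.IsArithmetic.isCusp_iff_isCusp_SL2Z] at hc
        rw [OnePoint.isBoundedAt_iff_forall_SL2Z hc]
        intro γ _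
        rw [SlashInvariantForm.slash_action_generators_SL2Z hgS hgT]
        rw [UpperHalfPlane.isBoundedAtImInfty_iff]
        exact ⟨K, 1, fun z hz => hb z hz⟩ }
  obtain ⟨c, hc⟩ := ModularFormClass.levelOne_weight_zero_const f
  refine ⟨c, fun z hz => ?_⟩
  exact congrFun hc ⟨z, hz⟩

lemma exists_values {φ : PowerSeries ℤ} {H : ℂ → ℂ}
    (h : ∀ z : ℂ, 0 < z.im → SV φ (qq z) (H z)) :
    ∃ F : ℂ → ℂ, (∀ q, ‖q‖ < 1 → SV φ q (F q)) ∧ ∀ z : ℂ, 0 < z.im → F (qq z) = H z := by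
  have h1 : ∀ q : ℂ, ∃ v, ‖q‖ < 1 → SV φ q v := by
    intro q
    by_cases hq : ‖q‖ < 1
    · by_cases h0 : q = 0
      · subst h0
        refine ⟨_, fun _ => SV.of_hasSum (hasSum_single (f := fun n => (φ.coeff n : ℂ) * (0:ℂ) ^ n) 0 (by
          intro n hn; simp [hn]))⟩
      · obtain ⟨z, hz, rfl⟩ := exists_qq h0 hq
        exact ⟨_, fun _ => h z hz⟩
    · exact ⟨0, fun h => absurd h hq⟩
  choose F hF using h1
  exact ⟨F, hF, fun z hz => (hF _ (norm_qq_lt hz)).unique (h z hz)⟩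

lemma norm_qq_le_half {z : ℂ} (hz : 1 ≤ z.im) : ‖qq z‖ ≤ 1 / 2 := by
  rw [qq, Complex.norm_exp]
  have h1 : (2 * Real.pi * Complex.I * z).re = -(2 * Real.pi * z.im) := by simp
  rw [h1, Real.exp_neg]
  have h2 : (2:ℝ) ≤ Real.exp (2 * Real.pi * z.im) := by
    have := Real.add_one_le_exp (2 * Real.pi * z.im)
    have := Real.pi_gt_three
    nlinarith
  rw [one_div]
  exact inv_anti₀ (by norm_num) h2

lemma zprinciple_zero {G : ℂ → ℂ} {φ : PowerSeries ℤ} (hG : DifferentiableOn ℂ G {z | 0 < z.im})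
    (hT : ∀ z : ℂ, 0 < z.im → G (z + 1) = G z) (hS : ∀ z : ℂ, 0 < z.im → G (-1 / z) = G z)
    (hφ : ∀ z : ℂ, 0 < z.im → SV φ (qq z) (G z)) :
    ∀ z : ℂ, 0 < z.im → G z = φ.coeff 0 := by
  obtain ⟨F, hF, hFG⟩ := exists_values hφ
  have hcont := (differentiableOn_of_SV hF).continuousOn
  have hsub : Metric.closedBall (0:ℂ) (1/2) ⊆ Metric.ball 0 1 :=
    Metric.closedBall_subset_ball (by norm_num)
  obtain ⟨K, hK⟩ := (isCompact_closedBall (0:ℂ) (1/2)).exists_bound_of_continuousOn (hcont.mono hsub)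
  obtain ⟨c, hc⟩ := const_of_bounded hG hT hS (K := K) (fun z hz => by
    rw [← hFG z (by linarith)]
    exact hK _ (by simpa using norm_qq_le_half hz))
  have h0 : F 0 = φ.coeff 0 := (hF 0 (by simp)).zero_right
  have h1 : ∀ q : ℂ, q ≠ 0 → ‖q‖ < 1 → F q = c := by
    intro q hq hq1
    obtain ⟨z, hz, rfl⟩ := exists_qq hq hq1
    rw [hFG z hz, hc z hz]
  have h2 : F 0 = c := by
    have hc0 : ContinuousAt F 0 := hcont.continuousAt (Metric.ball_mem_nhds 0 one_pos)
    have t1 : Filter.Tendsto F (nhdsWithin 0 {0}ᶜ) (nhds (F 0)) := hc0.mono_left nhdsWithin_le_nhds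
    have t2 : Filter.Tendsto F (nhdsWithin 0 {0}ᶜ) (nhds c) := by
      refine tendsto_const_nhds.congr' ?_
      rw [Filter.EventuallyEq, eventually_nhdsWithin_iff]
      filter_upwards [Metric.ball_mem_nhds (0:ℂ) one_pos] with q hq hq0
      exact (h1 q hq0 (by simpa using hq)).symm
    exact tendsto_nhds_unique t1 t2
  intro z hz
  rw [hc z hz, ← h2, h0]

lemma zprinciple (M : ℕ) : ∀ {G : ℂ → ℂ} {φ : PowerSeries ℤ},
    DifferentiableOn ℂ G {z | 0 < z.im} →
    (∀ z : ℂ, 0 < z.im → G (z + 1) = G z) → (∀ z : ℂ, 0 < z.im → G (-1 / z) = G z) →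
    (∀ z : ℂ, 0 < z.im → SV φ (qq z) (G z * qq z ^ M)) →
    ∃ P : Polynomial ℤ, ∀ z : ℂ, 0 < z.im → G z = Polynomial.aeval (jf z) P := by
  induction M with
  | zero =>
    intro G φ hG hT hS hφ
    refine ⟨Polynomial.C (φ.coeff 0), fun z hz => ?_⟩
    rw [zprinciple_zero hG hT hS (by simpa using hφ) z hz]
    simp
  | succ M ih =>
    intro G φ hG hT hS hφ
    obtain ⟨u, hu0, hu, -⟩ := exists_u
    set a := φ.coeff 0 with ha
    have hdvd : PowerSeries.X ∣ φ - PowerSeries.C a * u ^ (M + 1) := by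
      rw [PowerSeries.X_dvd_iff]
      rw [coeff_zero_eq_constantCoeff_apply] at hu0 ha
      simp [hu0, ha]
    obtain ⟨ψ, hψ⟩ := hdvd
    have key := ih (G := fun z => G z - a * jf z ^ (M + 1)) (φ := ψ) ?_ ?_ ?_ ?_
    · obtain ⟨P, hP⟩ := key
      refine ⟨P + Polynomial.C a * Polynomial.X ^ (M + 1), fun z hz => ?_⟩
      have := hP z hz
      simp only [map_add, map_mul, map_pow, Polynomial.aeval_X, ← this, Polynomial.aeval_C]
      simp
    · exact hG.sub ((differentiableOn_jf.pow _).const_mul _)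
    · intro z hz
      simp only [hT z hz, jf_add_one]
    · intro z hz
      have := (jf_moeb (a := 0) (b := -1) (c := 1) (d := 0) (by norm_num) hz).2
      simp only [hS z hz]
      norm_num at this
      rw [this]
    · intro z hz
      have h1 := (hφ z hz).sub ((SV.C a (qq z)).mul ((hu z hz).pow (M + 1)))
      rw [hψ] at h1
      have h2 := SV_of_X_mul (qq_ne_zero z) h1
      convert h2 using 1
      have := qq_ne_zero z
      field_simp
      ring

end LeechCM


namespace LeechCM

open PowerSeries

lemma jf_add_nat (z : ℂ) (n : ℕ) : jf (z + n) = jf z := by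
  induction n with
  | zero => simp
  | succ n ih => push_cast; rw [← add_assoc, jf_add_one, ih]

lemma jf_add_int (z : ℂ) (n : ℤ) : jf (z + n) = jf z := by
  obtain ⟨m, rfl | rfl⟩ := n.eq_nat_or_neg
  · exact_mod_cast jf_add_nat z m
  · have := jf_add_nat (z + ((-(m : ℤ) : ℤ) : ℂ)) m
    rw [← this]
    congr 1
    push_cast; ring

/-- `j((z+x)/p)` for a residue class `x` -/
noncomputable def jr (p : ℕ) (z : ℂ) (x : ZMod p) : ℂ := jf ((z + (x.val : ℕ)) / p)

lemma jr_int (p : ℕ) [NeZero p] (z : ℂ) (m : ℤ) : jr p z (m : ZMod p) = jf ((z + m) / p) := by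
  have hp : (p : ℂ) ≠ 0 := by exact_mod_cast NeZero.ne p
  have h1 : (((m : ZMod p).val : ℕ) : ℤ) = m % p := ZMod.val_intCast m
  have h2 : m = p * (m / p) + ((m : ZMod p).val : ℕ) := by rw [h1]; exact (Int.mul_ediv_add_emod m p).symm
  have h3 : (m : ℂ) = p * ((m / p : ℤ) : ℂ) + (((m : ZMod p).val : ℕ) : ℂ) := by exact_mod_cast h2
  rw [jr, ← jf_add_int _ (m / p)]
  congr 1
  rw [h3]
  field_simp
  ring

/-- power sums over the Hecke correspondence -/
noncomputable def hs (p n : ℕ) [NeZero p] (z : ℂ) : ℂ := jf (p * z) ^ n + ∑ x : ZMod p, jr p z x ^ n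

lemma hs_add_one (p n : ℕ) [NeZero p] (z : ℂ) : hs p n (z + 1) = hs p n z := by
  unfold hs
  rw [show (p : ℂ) * (z + 1) = p * z + p by ring, jf_add_nat]
  congr 1
  rw [← Equiv.sum_comp (Equiv.addRight (1 : ZMod p)) (fun x => jr p z x ^ n)]
  refine Finset.sum_congr rfl fun x _ => ?_
  congr 1
  have h1 : (Equiv.addRight (1 : ZMod p)) x = (((x.val + 1 : ℕ) : ℤ) : ZMod p) := by simp
  rw [h1, jr_int, jr]
  congr 1
  push_cast
  ring

lemma jf_neg_inv {z : ℂ} (hz : 0 < z.im) : jf (-1 / z) = jf z := by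
  have := (jf_moeb (a := 0) (b := -1) (c := 1) (d := 0) (by norm_num) hz).2
  norm_num at this
  exact this

lemma im_nat_mul {p : ℕ} (hp : 0 < p) {z : ℂ} (hz : 0 < z.im) : 0 < ((p : ℂ) * z).im := by
  simp; positivity

lemma im_add_div {p : ℕ} (hp : 0 < p) {z : ℂ} (hz : 0 < z.im) (m : ℤ) : 0 < ((z + m) / p).im := by
  simp; positivity

lemma jr_neg_inv {p : ℕ} [Fact p.Prime] {z : ℂ} (hz : 0 < z.im) {x : ZMod p} (hx : x ≠ 0) :
    jr p (-1 / z) x = jr p z (-x⁻¹) := by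
  have hp0 : 0 < p := (Fact.out : p.Prime).pos
  have hpc : (p : ℂ) ≠ 0 := by exact_mod_cast hp0.ne'
  have hz0 : z ≠ 0 := by rintro rfl; simp at hz
  set b : ℤ := (x.val : ℤ) with hb
  set b' : ℤ := ((-x⁻¹).val : ℤ) with hb'
  have hbx : (b : ZMod p) = x := by simp [hb]
  have hbx' : (b' : ZMod p) = -x⁻¹ := by simp [hb']
  have hdvd : (p : ℤ) ∣ -1 - b * b' := by
    rw [← ZMod.intCast_zmod_eq_zero_iff_dvd]
    push_cast
    rw [hbx, hbx']
    field_simp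
    ring
  obtain ⟨e, he⟩ := hdvd
  have he' : (-1 : ℂ) - b * b' = p * e := by exact_mod_cast he
  rw [← hbx', jr_int, ← hbx, jr_int]
  have h := (jf_moeb (a := b) (b := e) (c := p) (d := -b') (by linarith) (im_add_div hp0 hz b')).2
  rw [← h]
  congr 1
  have h2 : ((p : ℤ) : ℂ) * ((z + b') / p) + ((-b' : ℤ) : ℂ) = z := by
    push_cast; field_simp; ring
  rw [h2]
  field_simp
  linear_combination he'

lemma hs_neg_inv (p n : ℕ) [Fact p.Prime] {z : ℂ} (hz : 0 < z.im) : hs p n (-1 / z) = hs p n z := by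
  have hp0 : 0 < p := (Fact.out : p.Prime).pos
  have hpc : (p : ℂ) ≠ 0 := by exact_mod_cast hp0.ne'
  have hz0 : z ≠ 0 := by rintro rfl; simp at hz
  have split : ∀ w : ℂ, ∑ x : ZMod p, jr p w x ^ n =
      jf (w / p) ^ n + ∑ x : ZMod p, if x = 0 then 0 else jr p w x ^ n := by
    intro w
    have : jf (w / p) ^ n = ∑ x : ZMod p, if x = 0 then jr p w x ^ n else 0 := by
      rw [Finset.sum_ite_eq' ]; simp [jr]
    rw [this, ← Finset.sum_add_distrib]
    refine Finset.sum_congr rfl fun x _ => ?_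
    split_ifs <;> simp
  have inv : Function.Involutive (fun x : ZMod p => -x⁻¹) := by
    intro x; simp [inv_neg]
  have h1 : jf (p * (-1 / z)) = jf (z / p) := by
    rw [← jf_neg_inv (z := z / p) (by simpa using im_add_div hp0 hz 0)]
    congr 1; field_simp
  have h2 : jf (-1 / z / p) = jf (p * z) := by
    rw [← jf_neg_inv (im_nat_mul hp0 hz)]
    congr 1; field_simp
  have h3 : (∑ x : ZMod p, if x = 0 then 0 else jr p (-1 / z) x ^ n) =
      ∑ x : ZMod p, if x = 0 then 0 else jr p z x ^ n := by
    rw [← Equiv.sum_comp (inv.toPerm) (fun x => if x = 0 then 0 else jr p z x ^ n)]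
    refine Finset.sum_congr rfl fun x _ => ?_
    by_cases hx : x = 0
    · simp [hx]
    · have : (inv.toPerm) x ≠ 0 := by simp [hx]
      rw [if_neg hx, if_neg this, jr_neg_inv hz hx]
      rfl
  unfold hs
  rw [split, split, h1, h2, h3]
  ring

lemma differentiableOn_hs (p n : ℕ) [Fact p.Prime] : DifferentiableOn ℂ (hs p n) {z | 0 < z.im} := by
  have hp0 : 0 < p := (Fact.out : p.Prime).pos
  unfold hs
  refine DifferentiableOn.add ?_ (DifferentiableOn.fun_sum fun x _ => ?_)
  · refine DifferentiableOn.pow ?_ n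
    exact differentiableOn_jf.comp (f := fun z : ℂ => (p : ℂ) * z) (by fun_prop) fun z hz => im_nat_mul hp0 hz
  · refine DifferentiableOn.pow ?_ n
    exact differentiableOn_jf.comp (f := fun z : ℂ => (z + (x.val : ℕ)) / p) (by fun_prop) fun z hz => by
      simpa using im_add_div hp0 hz x.val

lemma qq_nat_mul (n : ℕ) (z : ℂ) : qq (n * z) = qq z ^ n := by
  rw [qq, qq, ← Complex.exp_nat_mul]
  congr 1; ring

lemma qq_add (z w : ℂ) : qq (z + w) = qq z * qq w := by
  rw [qq, qq, qq, ← Complex.exp_add, mul_add]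

lemma sum_zmod (p : ℕ) [NeZero p] (v : ℕ → ℂ) : ∑ x : ZMod p, v x.val = ∑ b ∈ Finset.range p, v b := by
  refine Finset.sum_bij' (fun x _ => x.val) (fun b _ => (b : ZMod p)) ?_ ?_ ?_ ?_ ?_
  · intro x _; simpa using ZMod.val_lt x
  · intro b _; simp
  · intro x _; simp
  · intro b hb; exact ZMod.val_cast_of_lt (by simpa using hb)
  · intro x _; rfl

lemma hecke_congr (p k : ℕ) [Fact p.Prime] : ∃ P : Polynomial ℤ, ∀ z : ℂ, 0 < z.im →
    hs p (p * k) z = p * jf z ^ k + jf z ^ (p ^ 2 * k) + p ^ 2 * Polynomial.aeval (jf z) P := by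
  have hp : p.Prime := Fact.out
  have hp0 : 0 < p := hp.pos
  have hpc : (p : ℂ) ≠ 0 := by exact_mod_cast hp0.ne'
  obtain ⟨u, hu0, hu, -⟩ := exists_u
  -- divisibility
  obtain ⟨r₁, hr₁⟩ : ((p ^ 2 : ℕ) : PowerSeries ℤ) ∣
      (u ^ (p * k)).expand p hp.ne_zero - u ^ (p ^ 2 * k) := by
    have h1 := dvd_sub_pow_of_dvd_sub (p := p) (dvd_expand_sub_pow p hp u) 1
    rw [map_pow, pow_mul, pow_mul]
    have h2 : u ^ p ^ 2 = (u ^ p) ^ p := by rw [← pow_mul, sq]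
    rw [h2]
    push_cast
    rw [pow_one] at h1
    exact h1.trans (sub_dvd_pow_sub_pow _ _ k)
  set w : PowerSeries ℤ := PowerSeries.X ^ ((p ^ 2 - 1) * k) * u ^ k with hw
  obtain ⟨r₂, hr₂⟩ := dvd_expand_sub_pow p hp w
  have hU : (p : PowerSeries ℤ) * Uop p (w ^ p) - p * w = ((p ^ 2 : ℕ) : PowerSeries ℤ) * (-Uop p r₂) := by
    have : w ^ p = w.expand p hp.ne_zero - p * r₂ := by rw [← hr₂]; ring
    rw [this, Uop_sub, Uop_expand, Uop_natCast_mul]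
    push_cast; ring
  have hexp : (p ^ 2 - 1) * k + k = p ^ 2 * k := by
    have : 1 ≤ p ^ 2 := Nat.one_le_pow _ _ hp0
    rw [← Nat.succ_mul]; congr 1; omega
  let G : ℂ → ℂ := fun z => (hs p (p * k) z - p * jf z ^ k - jf z ^ (p ^ 2 * k)) / ((p ^ 2 : ℕ) : ℂ)
  have key := zprinciple (p ^ 2 * k) (G := G) (φ := r₁ + -Uop p r₂) ?_ ?_ ?_ ?_
  · obtain ⟨P, hP⟩ := key
    refine ⟨P, fun z hz => ?_⟩
    rw [← hP z hz]
    simp only [G]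
    push_cast
    field_simp
    ring
  · exact (((differentiableOn_hs _ _).sub ((differentiableOn_jf.pow _).const_mul _)).sub
      (differentiableOn_jf.pow _)).div_const _
  · intro z hz
    simp only [G, hs_add_one, jf_add_one]
  · intro z hz
    simp only [G, hs_neg_inv _ _ hz, jf_neg_inv hz]
  · intro z hz
    have e1 : SV ((u ^ (p * k)).expand p hp.ne_zero) (qq z) ((jf (p * z) * qq (p * z)) ^ (p * k)) := by
      apply SV.expand
      rw [← qq_nat_mul]
      exact (hu _ (im_nat_mul hp0 hz)).pow _
    have e2 := (hu z hz).pow (p ^ 2 * k)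
    have e3 : SV (p * Uop p (w ^ p)) (qq z)
        ((∑ x : ZMod p, jr p z x ^ (p * k)) * qq z ^ (p ^ 2 * k)) := by
      have hζ := Complex.isPrimitiveRoot_exp p hp0.ne'
      have ht : qq (z / p) ^ p = qq z := by
        rw [← qq_nat_mul]; congr 1; field_simp
      have hb : ∀ b : ℕ, Complex.exp (2 * Real.pi * Complex.I / p) ^ b * qq (z / p) = qq ((z + b) / p) := by
        intro b
        rw [add_div, qq_add, mul_comm]
        congr 1
        rw [qq, ← Complex.exp_nat_mul]
        congr 1; field_simp
      have h1 := SV_Uop (φ := w ^ p) (t := qq (z / p)) hp0 hζ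
        (v := fun b => jf ((z + b) / p) ^ (p * k) * qq z ^ (p ^ 2 * k)) (fun b => ?_)
      · rw [ht, ← Finset.sum_mul, ← sum_zmod p (fun b => jf ((z + b) / p) ^ (p * k))] at h1
        exact h1
      · rw [hb]
        have him : 0 < ((z + b) / p).im := by simpa using im_add_div hp0 hz b
        have h2 := (((SV.X (qq ((z + b) / p))).pow ((p ^ 2 - 1) * k)).mul ((hu _ him).pow k)).pow p
        convert h2 using 1
        have h3 : qq z = qq ((z + b) / p) ^ p := by
          rw [← qq_nat_mul, mul_div_cancel₀ _ hpc, qq_add, ← mul_one (b : ℂ), qq_nat_mul]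
          have : qq 1 = 1 := by
            have := qq_add_one 0
            rw [zero_add] at this
            rw [this]; simp [qq]
          rw [this]; simp
        rw [h3, ← hexp]
        ring
    have e4 := (SV.natCast p (qq z)).mul (((SV.X (qq z)).pow ((p ^ 2 - 1) * k)).mul ((hu z hz).pow k))
    rw [← hw] at e4
    have e5 := (e1.sub e2).add (e3.sub e4)
    rw [hr₁, hU, ← mul_add] at e5
    have e6 := SV_of_mul (pow_ne_zero 2 hp0.ne') e5
    convert e6 using 1
    simp only [G, hs]
    rw [qq_nat_mul]
    have h4 : (jf (p * z) * qq z ^ p) ^ (p * k) = jf (p * z) ^ (p * k) * qq z ^ (p ^ 2 * k) := by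
      rw [mul_pow, ← pow_mul]; congr 2; ring
    have h5 : qq z ^ ((p ^ 2 - 1) * k) * (jf z * qq z) ^ k = jf z ^ k * qq z ^ (p ^ 2 * k) := by
      rw [← hexp, pow_add]; ring
    rw [h4, h5, mul_pow]
    ring

lemma rel_main (p : ℕ) (hp : p.Prime) {z : ℂ} (hz : 0 < z.im) (h : jf z = 720) :
    Rel p hp (jf (p * z) - 720) := by
  have : Fact p.Prime := ⟨hp⟩
  let α : Option (ZMod p) → ℂ := fun o => o.elim (jf (p * z)) (jr p z)
  have := rel_of_psum (ι := Option (ZMod p)) p hp (by simp [ZMod.card]) α 720 (by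
    intro k
    obtain ⟨P, hP⟩ := hecke_congr p k
    refine ⟨P.eval 720, ?_⟩
    have h1 := hP z hz
    rw [Fintype.sum_option]
    simp only [α, Option.elim]
    rw [hs] at h1
    rw [h1, h]
    have : (Polynomial.aeval (720 : ℂ)) P = ((P.eval 720 : ℤ) : ℂ) := by
      have := Polynomial.aeval_algebraMap_apply ℂ (720 : ℤ) P
      simpa using this
    rw [this]
    push_cast
    rfl) none
  simpa [α] using this

end LeechCM


namespace LeechCM

open UpperHalfPlane ModularGroup
open scoped MatrixGroups

lemma cm_coords {A B C : ℤ} {z : ℂ} (hz : 0 < z.im) (h : (A : ℂ) * z ^ 2 + B * z + C = 0) :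
    2 * A * z.re + B = 0 ∧ (2 * A * z.im) ^ 2 = -((B ^ 2 - 4 * A * C : ℤ) : ℝ) := by
  have hr := congrArg Complex.re h
  have hi := congrArg Complex.im h
  simp [sq] at hr hi
  have h1 : 2 * A * z.re + B = 0 := by
    have : z.im * (2 * A * z.re + B) = 0 := by linarith
    exact (mul_eq_zero.mp this).resolve_left hz.ne'
  refine ⟨h1, ?_⟩
  push_cast
  linear_combination (-4 * A : ℝ) * hr + (2 * A * z.re + B) * h1

/-- CM points of discriminant `D` -/
def CM (D : ℤ) (z : ℂ) : Prop :=
  0 < z.im ∧ ∃ A B C : ℤ, 0 < A ∧ B ^ 2 - 4 * A * C = D ∧ (A : ℂ) * z ^ 2 + B * z + C = 0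

lemma CM.neg {D : ℤ} {z : ℂ} (h : CM D z) : D < 0 := by
  obtain ⟨hz, A, B, C, hA, hD, he⟩ := h
  have := (cm_coords hz he).2
  rw [hD] at this
  have hA' : (0:ℝ) < A := by exact_mod_cast hA
  have : (0:ℝ) < (2 * A * z.im) ^ 2 := by positivity
  have : (D : ℝ) < 0 := by linarith
  exact_mod_cast this

lemma form_moeb {A B C a b c d : ℤ} (h : a * d - b * c = 1) {z : ℂ} (hz : 0 < z.im)
    (he : (A : ℂ) * z ^ 2 + B * z + C = 0) :
    ((A * d ^ 2 - B * d * c + C * c ^ 2 : ℤ) : ℂ) * ((a * z + b) / (c * z + d)) ^ 2 +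
      ((-2 * A * b * d + B * (a * d + b * c) - 2 * C * a * c : ℤ) : ℂ) * ((a * z + b) / (c * z + d)) +
      ((A * b ^ 2 - B * a * b + C * a ^ 2 : ℤ) : ℂ) = 0 := by
  have hne : (c : ℂ) * z + d ≠ 0 := by
    intro h0
    have hi := congrArg Complex.im h0
    have hr := congrArg Complex.re h0
    simp at hi hr
    have hc : c = 0 := hi.resolve_right hz.ne'
    subst hc
    simp at hr
    subst hr
    simp at h
  have h' : (a : ℂ) * d - b * c = 1 := by exact_mod_cast h
  have hw : ((a : ℂ) * z + b) / (c * z + d) * (c * z + d) = a * z + b := div_mul_cancel₀ _ hne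
  generalize ((a : ℂ) * z + b) / (c * z + d) = w at *
  have key : (c * z + d) ^ 2 * (((A * d ^ 2 - B * d * c + C * c ^ 2 : ℤ) : ℂ) * w ^ 2 +
      ((-2 * A * b * d + B * (a * d + b * c) - 2 * C * a * c : ℤ) : ℂ) * w +
      ((A * b ^ 2 - B * a * b + C * a ^ 2 : ℤ) : ℂ)) = 0 := by
    have e1 : (c * z + d) ^ 2 * (((A * d ^ 2 - B * d * c + C * c ^ 2 : ℤ) : ℂ) * w ^ 2 +
      ((-2 * A * b * d + B * (a * d + b * c) - 2 * C * a * c : ℤ) : ℂ) * w +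
      ((A * b ^ 2 - B * a * b + C * a ^ 2 : ℤ) : ℂ)) =
      ((A * d ^ 2 - B * d * c + C * c ^ 2 : ℤ) : ℂ) * (w * (c * z + d)) ^ 2 +
      ((-2 * A * b * d + B * (a * d + b * c) - 2 * C * a * c : ℤ) : ℂ) * (w * (c * z + d)) * (c * z + d) +
      ((A * b ^ 2 - B * a * b + C * a ^ 2 : ℤ) : ℂ) * (c * z + d) ^ 2 := by ring
    rw [e1, hw]
    push_cast
    linear_combination ((a : ℂ) * d - b * c) ^ 2 * he
  exact (mul_eq_zero.mp key).resolve_left (pow_ne_zero 2 hne)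

lemma disc_moeb {A B C a b c d : ℤ} (h : a * d - b * c = 1) :
    (-2 * A * b * d + B * (a * d + b * c) - 2 * C * a * c) ^ 2 -
      4 * (A * d ^ 2 - B * d * c + C * c ^ 2) * (A * b ^ 2 - B * a * b + C * a ^ 2) =
    B ^ 2 - 4 * A * C := by
  linear_combination (B ^ 2 - 4 * A * C) * (a * d - b * c + 1) * h

lemma posdef {A B C x y : ℤ} (hA : 0 < A) (hD : B ^ 2 - 4 * A * C < 0) (hxy : ¬ (x = 0 ∧ y = 0)) :
    0 < A * x ^ 2 + B * x * y + C * y ^ 2 := by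
  have h1 : 4 * A * (A * x ^ 2 + B * x * y + C * y ^ 2) =
      (2 * A * x + B * y) ^ 2 - (B ^ 2 - 4 * A * C) * y ^ 2 := by ring
  have h2 : 0 < 4 * A * (A * x ^ 2 + B * x * y + C * y ^ 2) := by
    rw [h1]
    by_cases hy : y = 0
    · subst hy
      have hx : x ≠ 0 := fun h => hxy ⟨h, rfl⟩
      have : 2 * A * x ≠ 0 := by positivity
      simp
      positivity
    · have : 0 < y ^ 2 := by positivity
      nlinarith [sq_nonneg (2 * A * x + B * y)]
  exact pos_of_mul_pos_right h2 (by linarith)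

lemma CM_finite (D : ℤ) : {v | ∃ z, CM D z ∧ jf z = v}.Finite := by
  let pt : ℤ × ℤ → ℂ := fun ab => ⟨-ab.2 / (2 * ab.1), Real.sqrt (-D) / (2 * ab.1)⟩
  refine (((Set.finite_Icc (0:ℤ) (-D)).prod (Set.finite_Icc D (-D))).image (fun ab => jf (pt ab))).subset ?_
  rintro v ⟨z, hz, rfl⟩
  have hD := hz.neg
  obtain ⟨hz, A, B, C, hA, hdisc, he⟩ := hz
  obtain ⟨γ, hγ⟩ := exists_smul_mem_fd ⟨z, hz⟩
  have hj := jf_smul γ ⟨z, hz⟩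
  have hdet : γ 0 0 * γ 1 1 - γ 0 1 * γ 1 0 = 1 := by
    have := γ.det_coe
    rw [Matrix.det_fin_two] at this
    exact this
  have hf := form_moeb hdet hz he
  have hd := disc_moeb (A := A) (B := B) (C := C) hdet
  have hw : ((γ • (⟨z, hz⟩ : ℍ) : ℍ) : ℂ) = (γ 0 0 * z + γ 0 1) / (γ 1 0 * z + γ 1 1) := by
    rw [coe_specialLinearGroup_apply]
    simp
  rw [← hw] at hf
  set w := γ • (⟨z, hz⟩ : ℍ) with hwdef
  have hA' : 0 < A * (γ 1 1) ^ 2 - B * (γ 1 1) * (γ 1 0) + C * (γ 1 0) ^ 2 := by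
    have := posdef (x := γ 1 1) (y := -γ 1 0) hA (by rw [hdisc]; exact hD) (by
      rintro ⟨h1, h2⟩
      rw [neg_eq_zero] at h2
      rw [h1, h2] at hdet
      simp at hdet)
    nlinarith
  generalize A * (γ 1 1) ^ 2 - B * (γ 1 1) * (γ 1 0) + C * (γ 1 0) ^ 2 = A' at *
  generalize -2 * A * γ 0 1 * γ 1 1 + B * (γ 0 0 * γ 1 1 + γ 0 1 * γ 1 0) - 2 * C * γ 0 0 * γ 1 0 = B' at *
  generalize A * γ 0 1 ^ 2 - B * γ 0 0 * γ 0 1 + C * γ 0 0 ^ 2 = C' at *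
  have hwim : 0 < (w : ℂ).im := w.im_pos
  obtain ⟨h1, h2⟩ := cm_coords hwim hf
  rw [hd, hdisc] at h2
  obtain ⟨hn, hre⟩ := hγ
  have hAr : (0:ℝ) < A' := by exact_mod_cast hA'
  have hre' : |(w : ℂ).re| ≤ 1 / 2 := hre
  rw [abs_le] at hre'
  have hB1 : (B' : ℝ) ≤ A' := by nlinarith
  have hB2 : -(A' : ℝ) ≤ B' := by nlinarith
  have hB1' : B' ≤ A' := by exact_mod_cast hB1
  have hB2' : -A' ≤ B' := by exact_mod_cast hB2
  have hn' : 1 ≤ (w : ℂ).re * (w : ℂ).re + (w : ℂ).im * (w : ℂ).im := by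
    rw [← Complex.normSq_apply]; exact hn
  have h3 : (4:ℝ) * A' ^ 2 ≤ B' ^ 2 - D := by
    have e : (B' : ℝ) = -(2 * A' * (w : ℂ).re) := by linarith
    rw [e]
    nlinarith [mul_le_mul_of_nonneg_left hn' (by positivity : (0:ℝ) ≤ 4 * A' ^ 2)]
  have h3' : 4 * A' ^ 2 ≤ B' ^ 2 - D := by exact_mod_cast h3
  have h4 : A' ≤ -D := by nlinarith
  refine ⟨(A', B'), ⟨⟨hA'.le, h4⟩, ⟨by simp; linarith, by simp; linarith⟩⟩, ?_⟩
  simp only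

  rw [← show jf w = jf z from hj]
  congr 1
  apply Complex.ext
  · simp only [pt]
    rw [div_eq_iff (by positivity)]
    linarith
  · simp only [pt]
    rw [← h2, Real.sqrt_sq (by positivity)]
    field_simp

lemma exists_good (D : ℤ) : ∃ N : ℕ, N ≠ 0 ∧ ∀ p : ℕ, p.Prime → ¬ p ∣ N → ∀ z : ℂ, 0 < z.im →
    jf z = 720 → CM D (p * z) → jf (p * z) = 720 := by
  classical
  have hfin := CM_finite D
  have h1 : ∀ v : ℂ, ∃ N : ℕ, N ≠ 0 ∧ (v ≠ 720 → ∀ p (hp : p.Prime), ¬ p ∣ N → ¬ Rel p hp (v - 720)) := by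
    intro v
    by_cases hv : v = 720
    · exact ⟨1, one_ne_zero, fun h => absurd hv h⟩
    · obtain ⟨N, hN, h⟩ := bad_primes (v - 720) (sub_ne_zero.mpr hv)
      exact ⟨N, hN, fun _ => h⟩
  choose f hf0 hf using h1
  refine ⟨∏ v ∈ hfin.toFinset, f v, Finset.prod_ne_zero_iff.mpr fun v _ => hf0 v, ?_⟩
  intro p hp hpN z hz hj hcm
  by_contra hne
  refine hf _ hne p hp (fun hd => hpN (hd.trans ?_)) (rel_main p hp hz hj)
  exact Finset.dvd_prod_of_mem _ (hfin.mem_toFinset.mpr ⟨_, hcm, rfl⟩)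

lemma strip {D : ℤ} {N : ℕ} (hN : ∀ p : ℕ, p.Prime → ¬ p ∣ N → ∀ z : ℂ, 0 < z.im →
    jf z = 720 → CM D (p * z) → jf (p * z) = 720) (m : ℕ) :
    0 < m → (∀ p : ℕ, p.Prime → p ∣ m → ¬ p ∣ N) → ∀ (B C : ℤ) (z : ℂ), 0 < z.im →
      B ^ 2 - 4 * m * C = D → (m : ℂ) * z ^ 2 + B * z + C = 0 → jf z = 720 → jf (m * z) = 720 := by
  induction m using induction_on_primes with
  | zero => intro h; exact absurd h (lt_irrefl 0)
  | one => intro _ _ B C z _ _ _ hj; simpa using hj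
  | prime_mul p n hp ih =>
    intro hpos hco B C z hz hD he hj
    have hn : 0 < n := Nat.pos_of_mul_pos_left hpos
    have hz' := im_nat_mul hp.pos hz
    have he' : (n : ℂ) * (p * z) ^ 2 + B * (p * z) + ((p * C : ℤ) : ℂ) = 0 := by
      push_cast at he ⊢
      linear_combination (p : ℂ) * he
    have hD' : B ^ 2 - 4 * n * (p * C) = D := by
      rw [← hD]; push_cast; ring
    have hj' := hN p hp (hco p hp (dvd_mul_right p n)) z hz hj
      ⟨hz', n, B, p * C, by exact_mod_cast hn, hD', by exact_mod_cast he'⟩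
    have := ih hn (fun r hr hd => hco r hr (hd.trans (dvd_mul_left n p))) B (p * C) (p * z) hz' hD' he' hj'
    rw [← this]
    congr 1
    push_cast; ring

lemma exists_coprime_rep {A B C : ℤ} (hprim : ∀ p : ℕ, p.Prime → ¬ ((p : ℤ) ∣ A ∧ (p : ℤ) ∣ B ∧ (p : ℤ) ∣ C))
    {N : ℕ} (hN : N ≠ 0) : ∃ x y : ℤ, IsCoprime x y ∧
      ∀ p : ℕ, p.Prime → p ∣ N → ¬ (p : ℤ) ∣ A * x ^ 2 + B * x * y + C * y ^ 2 := by
  classical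
  set X : Finset ℕ := N.primeFactors.filter (fun p : ℕ => (p : ℤ) ∣ A ∧ ¬ (p : ℤ) ∣ C) with hX
  set Y : Finset ℕ := N.primeFactors.filter (fun p : ℕ => ¬ (p : ℤ) ∣ A) with hY
  have hdvd : ∀ S : Finset ℕ, S ⊆ N.primeFactors → ∀ p : ℕ, p.Prime →
      ((p : ℤ) ∣ ((∏ r ∈ S, r : ℕ) : ℤ) ↔ p ∈ S) := by
    intro S hS p hp
    rw [Int.natCast_dvd_natCast, hp.prime.dvd_finset_prod_iff]
    constructor
    · rintro ⟨r, hr, hd⟩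
      rwa [(Nat.prime_dvd_prime_iff_eq hp (Nat.prime_of_mem_primeFactors (hS hr))).mp hd]
    · intro h; exact ⟨p, h, dvd_rfl⟩
  have hXs : X ⊆ N.primeFactors := Finset.filter_subset _ _
  have hYs : Y ⊆ N.primeFactors := Finset.filter_subset _ _
  refine ⟨((∏ r ∈ X, r : ℕ) : ℤ), ((∏ r ∈ Y, r : ℕ) : ℤ), ?_, ?_⟩
  · rw [Nat.isCoprime_iff_coprime]
    apply Nat.coprime_of_dvd
    intro p hp h1 h2
    have h1' := (hdvd X hXs p hp).mp (by exact_mod_cast h1)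
    have h2' := (hdvd Y hYs p hp).mp (by exact_mod_cast h2)
    rw [hX, Finset.mem_filter] at h1'
    rw [hY, Finset.mem_filter] at h2'
    exact h2'.2 h1'.2.1
  · intro p hp hpN hd
    have hpm : p ∈ N.primeFactors := Nat.mem_primeFactors.mpr ⟨hp, hpN, hN⟩
    have hpI : Prime (p : ℤ) := Nat.prime_iff_prime_int.mp hp
    have dX := hdvd X hXs p hp
    have dY := hdvd Y hYs p hp
    generalize ((∏ r ∈ X, r : ℕ) : ℤ) = x at *
    generalize ((∏ r ∈ Y, r : ℕ) : ℤ) = y at *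
    have mX : p ∈ X ↔ (p : ℤ) ∣ A ∧ ¬ (p : ℤ) ∣ C := by rw [hX, Finset.mem_filter]; simp [hpm]
    have mY : p ∈ Y ↔ ¬ (p : ℤ) ∣ A := by rw [hY, Finset.mem_filter]; simp [hpm]
    rw [mX] at dX
    rw [mY] at dY
    by_cases hA : (p : ℤ) ∣ A
    · have ny : ¬ (p : ℤ) ∣ y := fun h => (dY.mp h) hA
      by_cases hC : (p : ℤ) ∣ C
      · have nx : ¬ (p : ℤ) ∣ x := fun h => (dX.mp h).2 hC
        have hB : ¬ (p : ℤ) ∣ B := fun h => hprim p hp ⟨hA, h, hC⟩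
        have h1 : (p : ℤ) ∣ B * x * y := by
          have := (hd.sub (hA.mul_right (x ^ 2))).sub (hC.mul_right (y ^ 2))
          rwa [show A * x ^ 2 + B * x * y + C * y ^ 2 - A * x ^ 2 - C * y ^ 2 = B * x * y by ring] at this
        rcases hpI.dvd_or_dvd h1 with h | h
        · rcases hpI.dvd_or_dvd h with h | h
          · exact hB h
          · exact nx h
        · exact ny h
      · have hx : (p : ℤ) ∣ x := dX.mpr ⟨hA, hC⟩
        have h1 : (p : ℤ) ∣ C * y ^ 2 := by
          have := hd.sub (hx.mul_left (A * x + B * y))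
          rwa [show A * x ^ 2 + B * x * y + C * y ^ 2 - (A * x + B * y) * x = C * y ^ 2 by ring] at this
        rcases hpI.dvd_or_dvd h1 with h | h
        · exact hC h
        · exact ny (hpI.dvd_of_dvd_pow h)
    · have hy : (p : ℤ) ∣ y := dY.mpr hA
      have nx : ¬ (p : ℤ) ∣ x := fun h => hA (dX.mp h).1
      have h1 : (p : ℤ) ∣ A * x ^ 2 := by
        have := hd.sub (hy.mul_left (B * x + C * y))
        rwa [show A * x ^ 2 + B * x * y + C * y ^ 2 - (B * x + C * y) * y = A * x ^ 2 by ring] at this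
      rcases hpI.dvd_or_dvd h1 with h | h
      · exact hA h
      · exact nx (hpI.dvd_of_dvd_pow h)

lemma reduce_to_principal {A B C : ℤ} (hA : 0 < A)
    (hprim : ∀ p : ℕ, p.Prime → ¬ ((p : ℤ) ∣ A ∧ (p : ℤ) ∣ B ∧ (p : ℤ) ∣ C))
    {z : ℂ} (hz : 0 < z.im) (he : (A : ℂ) * z ^ 2 + B * z + C = 0) (hj : jf z = 720) :
    ∃ (B' C' : ℤ) (w : ℂ), 0 < w.im ∧ w ^ 2 + B' * w + C' = 0 ∧ jf w = 720 := by
  have hneg : B ^ 2 - 4 * A * C < 0 := CM.neg (z := z) ⟨hz, A, B, C, hA, rfl, he⟩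
  obtain ⟨N, hN0, hN⟩ := exists_good (B ^ 2 - 4 * A * C)
  obtain ⟨x, y, ⟨a, b, hab⟩, hxy⟩ := exists_coprime_rep hprim hN0
  have hdet : a * x - b * (-y) = 1 := by linarith
  obtain ⟨him, hj1⟩ := jf_moeb hdet hz
  have hf := form_moeb hdet hz he
  have hd := disc_moeb (A := A) (B := B) (C := C) hdet
  have hmpos : 0 < A * x ^ 2 + B * x * y + C * y ^ 2 := posdef hA hneg (by
    rintro ⟨rfl, rfl⟩; simp at hab)
  have e : A * x ^ 2 - B * x * (-y) + C * (-y) ^ 2 = A * x ^ 2 + B * x * y + C * y ^ 2 := by ring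
  rw [e] at hf hd
  generalize A * x ^ 2 + B * x * y + C * y ^ 2 = m at *
  generalize -2 * A * b * x + B * (a * x + b * -y) - 2 * C * a * -y = B' at *
  generalize A * b ^ 2 - B * a * b + C * a ^ 2 = C' at *
  generalize ((a : ℂ) * z + b) / (((-y : ℤ) : ℂ) * z + x) = w at *
  obtain ⟨m, rfl⟩ := Int.eq_ofNat_of_zero_le hmpos.le
  have hm : 0 < m := by exact_mod_cast hmpos
  have hjm := strip hN m hm (fun p hp hpm hpN => hxy p hp hpN (by exact_mod_cast hpm)) B' C' w him hd
    (by exact_mod_cast hf) (by rw [hj1, hj])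
  refine ⟨B', m * C', m * w, im_nat_mul hm him, ?_, hjm⟩
  push_cast at hf ⊢
  linear_combination (m : ℂ) * hf

lemma exists_primitive {P B C : ℤ} (hP : P ≠ 0) {z : ℂ}
    (he : (P : ℂ) * z ^ 2 + B * z + C = 0) :
    ∃ A' B' C' : ℤ, 0 < A' ∧
      (∀ p : ℕ, p.Prime → ¬ ((p : ℤ) ∣ A' ∧ (p : ℤ) ∣ B' ∧ (p : ℤ) ∣ C')) ∧
      (A' : ℂ) * z ^ 2 + B' * z + C' = 0 := by
  -- minimal positive leading coefficient
  have hex : ∃ n : ℕ, 0 < n ∧ ∃ B' C' : ℤ, (n : ℂ) * z ^ 2 + B' * z + C' = 0 := by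
    rcases lt_or_gt_of_ne hP with h | h
    · refine ⟨(-P).toNat, by omega, -B, -C, ?_⟩
      have : (((-P).toNat : ℤ) : ℂ) = ((-P : ℤ) : ℂ) := by rw [Int.toNat_of_nonneg (by omega)]
      rw [Int.cast_natCast] at this
      rw [this]
      push_cast
      linear_combination -he
    · refine ⟨P.toNat, by omega, B, C, ?_⟩
      have : ((P.toNat : ℤ) : ℂ) = (P : ℂ) := by rw [Int.toNat_of_nonneg (by omega)]
      rw [Int.cast_natCast] at this
      rw [this]
      exact he
  classical
  obtain ⟨hpos, B', C', h⟩ := Nat.find_spec hex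
  refine ⟨Nat.find hex, B', C', by exact_mod_cast hpos, ?_, by exact_mod_cast h⟩
  rintro p hp ⟨⟨a, ha⟩, ⟨b, rfl⟩, ⟨c, rfl⟩⟩
  have hp' : (0:ℤ) < p := by exact_mod_cast hp.pos
  have hpc : (p : ℂ) ≠ 0 := by exact_mod_cast hp.ne_zero
  have hapos : 0 < a := by
    have : (0:ℤ) < p * a := by rw [← ha]; exact_mod_cast hpos
    exact pos_of_mul_pos_right this hp'.le
  obtain ⟨n, rfl⟩ := Int.eq_ofNat_of_zero_le hapos.le
  have ha' : Nat.find hex = p * n := by exact_mod_cast ha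
  have hn : 0 < n := by exact_mod_cast hapos
  have hlt : n < Nat.find hex := by
    rw [ha']; nlinarith [hp.two_le]
  refine Nat.find_min hex hlt ⟨hn, b, c, ?_⟩
  rw [ha'] at h
  push_cast at h
  have : (p : ℂ) * (n * z ^ 2 + b * z + c) = 0 := by linear_combination h
  exact (mul_eq_zero.mp this).resolve_left hpc

end LeechCM

namespace LeechCM

open UpperHalfPlane ModularGroup
open scoped MatrixGroups

/-- Real version of the divisor-sum series. -/
noncomputable def rsv (k : ℕ) (r : ℝ) : ℝ :=
  ∑' n : ℕ, (∑ d ∈ Nat.divisors (n + 1), (d : ℝ) ^ k) * r ^ (n + 1)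

lemma sv_ofReal (k : ℕ) (r : ℝ) : sv k (r : ℂ) = (rsv k r : ℂ) := by
  rw [sv, rsv, Complex.ofReal_tsum]
  congr 1
  ext n
  push_cast
  rfl

lemma rsv_nonneg (k : ℕ) {r : ℝ} (hr : 0 ≤ r) : 0 ≤ rsv k r := by
  apply tsum_nonneg
  intro n
  positivity

lemma rsv_bound {r : ℝ} (hr : |r| < 1 / 256) : |rsv 3 r| < 1 / 240 := by
  have hg : ‖16 * |r|‖ < 1 := by
    rw [Real.norm_eq_abs, abs_of_nonneg (by positivity)]; linarith
  have hs : HasSum (fun n : ℕ => |r| * (16 * |r|) ^ n) (|r| * (1 - 16 * |r|)⁻¹) :=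
    (hasSum_geometric_of_norm_lt_one hg).mul_left _
  have hb : ∀ n : ℕ, ‖(∑ d ∈ Nat.divisors (n + 1), (d : ℝ) ^ 3) * r ^ (n + 1)‖ ≤ |r| * (16 * |r|) ^ n := by
    intro n
    have h1 : (∑ d ∈ Nat.divisors (n + 1), (d : ℝ) ^ 3) =
        ((ArithmeticFunction.sigma 3 (n + 1) : ℕ) : ℝ) := by
      simp [ArithmeticFunction.sigma_apply]
    have h2 : ((ArithmeticFunction.sigma 3 (n + 1) : ℕ) : ℝ) ≤ (16 : ℝ) ^ n := by
      have h3 := ArithmeticFunction.sigma_le_pow_succ 3 (n + 1)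
      have h4 : n + 1 ≤ 2 ^ n := Nat.lt_two_pow_self
      have h5 : (n + 1) ^ (3 + 1) ≤ (2 ^ n) ^ (3 + 1) := Nat.pow_le_pow_left h4 _
      have h6 : (2 ^ n) ^ (3 + 1) = 16 ^ n := by rw [← pow_mul, mul_comm, pow_mul]; norm_num
      exact_mod_cast h3.trans (h5.trans h6.le)
    rw [h1, norm_mul, norm_pow, Real.norm_eq_abs, Real.norm_eq_abs, Nat.abs_cast]
    calc _ ≤ (16 : ℝ) ^ n * |r| ^ (n + 1) := by gcongr
      _ = _ := by rw [mul_pow]; ring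
  have := tsum_of_norm_bounded hs hb
  rw [Real.norm_eq_abs] at this
  refine lt_of_le_of_lt this ?_
  rw [← div_eq_mul_inv, div_lt_iff₀ (by linarith)]
  linarith

lemma qq_of_coords {w : ℂ} {B : ℤ} (h : 2 * w.re = -B) :
    qq w = (((-1 : ℝ) ^ B * Real.exp (-2 * Real.pi * w.im) : ℝ) : ℂ) := by
  have hw : w = ((-B / 2 : ℝ) : ℂ) + (w.im : ℂ) * Complex.I := by
    conv_lhs => rw [← Complex.re_add_im w]
    rw [show w.re = -B / 2 by linarith]
  have e : 2 * (Real.pi : ℂ) * Complex.I * w =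
      ((-B : ℤ) : ℂ) * (Real.pi * Complex.I) + ((-2 * Real.pi * w.im : ℝ) : ℂ) := by
    conv_lhs => rw [hw]
    push_cast
    linear_combination 2 * (Real.pi : ℂ) * w.im * Complex.I_sq
  rw [qq, e, Complex.exp_add, Complex.exp_int_mul, Complex.exp_pi_mul_I, ← Complex.ofReal_exp]
  have : (-1 : ℂ) ^ (-B) = (-1) ^ B := by
    rw [zpow_neg]
    rcases Int.even_or_odd B with h | h
    · rw [h.neg_one_zpow]; simp
    · rw [h.neg_one_zpow]; norm_num
  rw [this]
  push_cast
  rfl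

lemma E4_add_one (z : ℂ) : E4 (z + 1) = E4 z := by simp only [E4, qq_add_one]

lemma E4_add_nat (z : ℂ) (n : ℕ) : E4 (z + n) = E4 z := by
  induction n with
  | zero => simp
  | succ n ih => rw [Nat.cast_succ, ← add_assoc, E4_add_one, ih]

lemma E4_add_int (z : ℂ) (n : ℤ) : E4 (z + n) = E4 z := by
  obtain ⟨m, rfl | rfl⟩ := n.eq_nat_or_neg
  · exact_mod_cast E4_add_nat z m
  · have := E4_add_nat (z + ((-m : ℤ) : ℂ)) m
    rw [← this]; congr 1; push_cast; ring

lemma E4_rho {z : ℂ} (hz : 0 < z.im) (he : z ^ 2 + z + 1 = 0) : E4 z = 0 := by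
  have h := E4_smul S ⟨z, hz⟩
  have hz0 : z ≠ 0 := by rintro rfl; simp at hz
  rw [denom_S, modular_S_smul] at h
  change E4 ((-z)⁻¹) = z ^ 4 * E4 z at h
  have h1 : (-z)⁻¹ = z + 1 := by
    apply inv_eq_of_mul_eq_one_right
    linear_combination -he
  rw [h1, E4_add_one] at h
  have h3 : z ^ 4 = z := by linear_combination (z ^ 2 - z) * he
  rw [h3] at h
  have h4 : (z - 1) * E4 z = 0 := by linear_combination -h
  refine (mul_eq_zero.mp h4).resolve_left ?_
  intro h5
  have := congrArg Complex.im h5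
  simp at this
  exact hz.ne' this

lemma exp_small {y : ℝ} (hy : 7 ≤ (2 * y) ^ 2) (hy0 : 0 < y) :
    Real.exp (-2 * Real.pi * y) < 1 / 256 := by
  have h1 : 2.5 ≤ 2 * y := by nlinarith
  have h2 : (7 : ℝ) ≤ 2 * Real.pi * y := by nlinarith [Real.pi_gt_three]
  have h3 : Real.exp (-2 * Real.pi * y) ≤ Real.exp (-7) := Real.exp_le_exp.mpr (by linarith)
  have h4 : (256 : ℝ) < Real.exp 7 := by
    have : Real.exp 7 = Real.exp 1 ^ 7 := by rw [← Real.exp_nat_mul]; norm_num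
    rw [this]
    calc (256 : ℝ) < 2.7 ^ 7 := by norm_num
      _ ≤ _ := by gcongr; linarith [Real.exp_one_gt_d9]
  refine lt_of_le_of_lt h3 ?_
  rw [Real.exp_neg, inv_eq_one_div]
  exact one_div_lt_one_div_of_lt (by norm_num) h4

lemma principal_false {B C : ℤ} {w : ℂ} (hw : 0 < w.im) (he : w ^ 2 + B * w + C = 0)
    (hj : E4 w ^ 3 = 720 * Delta w) : False := by
  have hD := Delta_ne_zero hw
  obtain ⟨hre, him⟩ := cm_coords (A := 1) (B := B) (C := C) hw (by push_cast; linear_combination he)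
  push_cast at hre him
  have hq := qq_of_coords (w := w) (B := B) (by linarith)
  set r : ℝ := (-1 : ℝ) ^ B * Real.exp (-2 * Real.pi * w.im) with hr
  have h4 : E4 w = ((1 + 240 * rsv 3 r : ℝ) : ℂ) := by
    push_cast; rw [← sv_ofReal, ← hq]; rfl
  have h6 : E6 w = ((1 - 504 * rsv 5 r : ℝ) : ℂ) := by
    push_cast; rw [← sv_ofReal, ← hq]; rfl
  have hE4 : E4 w ≠ 0 := by
    intro h0
    rw [h0] at hj
    apply hD
    have : (720 : ℂ) * Delta w = 0 := by rw [← hj]; simp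
    simpa using this
  have hx0 : 1 + 240 * rsv 3 r ≤ 0 := by
    rw [Delta, h4, h6] at hj
    generalize 1 + 240 * rsv 3 r = x at *
    generalize 1 - 504 * rsv 5 r = y at *
    have hj' : x ^ 3 = 720 * ((x ^ 3 - y ^ 2) / 1728) := by exact_mod_cast hj
    by_contra hx
    push Not at hx
    have : 0 < x ^ 3 := by positivity
    nlinarith [sq_nonneg y]
  have hexp := Real.exp_pos (-2 * Real.pi * w.im)
  rcases Int.even_or_odd B with hB | hB
  · have : 0 ≤ r := by rw [hr, hB.neg_one_zpow]; linarith
    linarith [rsv_nonneg 3 this]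
  · have hy0 : 0 < (2 * w.im) ^ 2 := by positivity
    obtain ⟨t, ht⟩ := hB
    have hn : (2 * w.im) ^ 2 = ((4 * (C - t ^ 2 - t) - 1 : ℤ) : ℝ) := by
      push_cast
      have : (B : ℝ) = 2 * t + 1 := by exact_mod_cast ht
      rw [this] at him
      linear_combination him
    have hpos : (0 : ℤ) < 4 * (C - t ^ 2 - t) - 1 := by
      rw [hn] at hy0; exact_mod_cast hy0
    rcases eq_or_ne (C - t ^ 2 - t) 1 with h1 | h1
    · apply hE4
      rw [← E4_add_int w t]
      apply E4_rho
      · simpa using hw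
      · have h1' : (C : ℂ) - t ^ 2 - t = 1 := by exact_mod_cast h1
        have : (B : ℂ) = 2 * t + 1 := by exact_mod_cast ht
        rw [this] at he
        linear_combination he - h1'
    · have h7 : 7 ≤ 4 * (C - t ^ 2 - t) - 1 := by omega
      have h7' : (7 : ℝ) ≤ (2 * w.im) ^ 2 := by rw [hn]; exact_mod_cast h7
      have hs := exp_small h7' hw
      have habs : |r| < 1 / 256 := by
        rw [hr, Odd.neg_one_zpow ⟨t, ht⟩, neg_one_mul, abs_neg, abs_of_pos hexp]
        exact hs
      have := (abs_lt.mp (rsv_bound habs)).1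
      linarith

end LeechCM

/-- No quadratic irrationality `τ₀ ∈ ℍ` satisfies `E₄(τ₀)³ = 720·Δ(τ₀)`; i.e. every
zero of the Leech lattice theta function `E₄³ − 720Δ = Δ·(j − 720)` is a non-CM point. -/
theorem leech_theta_zeros_not_CM :
    ¬ ∃ τ₀ : ℂ, 0 < τ₀.im ∧
      (∃ P B C : ℤ, P ≠ 0 ∧ (P : ℂ) * τ₀ ^ 2 + (B : ℂ) * τ₀ + (C : ℂ) = 0) ∧
      E4 τ₀ ^ 3 = 720 * Delta τ₀ := by
  rintro ⟨τ, hτ, ⟨P, B, C, hP, he⟩, h⟩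
  obtain ⟨A', B', C', hA, hprim, he'⟩ := LeechCM.exists_primitive hP he
  have hj : LeechCM.jf τ = 720 := by
    rw [LeechCM.jf, div_eq_iff (LeechCM.Delta_ne_zero hτ)]
    exact h
  obtain ⟨B1, C1, w, hw, hew, hjw⟩ := LeechCM.reduce_to_principal hA hprim hτ he' hj
  rw [LeechCM.jf, div_eq_iff (LeechCM.Delta_ne_zero hw)] at hjw
  exact LeechCM.principal_false hw hew hjw
end

section
/- If f is a modular form of weight 12 for SL₂(ℤ) whose q-expansion f(τ) = ∑_{n≥0} a_f(n)qⁿ satisfies a_f(0) = 1 and a_f(1) = 0, then f = E₄³ − 720·Δ as functions on ℍ; equivalently, 12·f = 7·E₄³ + 5·E₆². -/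
open scoped BigOperators

open UpperHalfPlane ModularForm ModularFormClass MatrixGroups EisensteinSeries

lemma E4_eq (z : ℍ) : E4 z = E₄ z := by
  have h := EisensteinSeries.q_expansion_bernoulli (k := 4) (by norm_num) ⟨2, rfl⟩ z
  rw [show E₄ z = E (k := 4) (by norm_num) z from rfl, h, E4,
    ← tsum_pnat_eq_tsum_succ (f := fun n : ℕ => (∑ d ∈ Nat.divisors n, (d : ℂ) ^ 3) * qq z ^ n)]
  norm_num [show bernoulli 4 = -1 / 30 by decide +kernel, ArithmeticFunction.sigma_apply, qq]

lemma E6_eq (z : ℍ) : E6 z = E₆ z := by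
  have h := EisensteinSeries.q_expansion_bernoulli (k := 6) (by norm_num) ⟨3, rfl⟩ z
  rw [show E₆ z = E (k := 6) (by norm_num) z from rfl, h, E6,
    ← tsum_pnat_eq_tsum_succ (f := fun n : ℕ => (∑ d ∈ Nat.divisors n, (d : ℂ) ^ 5) * qq z ^ n)]
  norm_num [show bernoulli 6 = 1 / 42 by decide +kernel, ArithmeticFunction.sigma_apply, qq]

noncomputable def mkForm (f : ℂ → ℂ)
    (hol : DifferentiableOn ℂ f {τ : ℂ | 0 < τ.im})
    (hmod : ∀ a b c d : ℤ, a * d - b * c = 1 → ∀ τ : ℂ, 0 < τ.im →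
      f (((a : ℂ) * τ + b) / ((c : ℂ) * τ + d)) = ((c : ℂ) * τ + d) ^ 12 * f τ)
    (hbdd : ∃ A M : ℝ, ∀ τ : ℂ, 0 < τ.im → A ≤ τ.im → ‖f τ‖ ≤ M) :
    ModularForm 𝒮ℒ 12 :=
  have key : ∀ γ : SL(2, ℤ), (fun z : ℍ => f z) ∣[(12 : ℤ)] γ = fun z : ℍ => f z := by
    intro γ
    ext z
    have hd : denom γ z ≠ 0 := denom_ne_zero _ z
    have h := hmod (γ 0 0) (γ 0 1) (γ 1 0) (γ 1 1)
      (by have := γ.det_coe; rwa [Matrix.det_fin_two] at this) z z.im_pos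
    rw [ModularForm.SL_slash_apply, UpperHalfPlane.coe_specialLinearGroup_apply]
    have hden : denom γ z = (γ 1 0 : ℂ) * z + γ 1 1 := by
      simp [denom]
    simp only [algebraMap_int_eq, eq_intCast, Complex.ofReal_intCast]
    rw [h, ← hden, zpow_neg]
    field_simp
  { toFun := fun z => f z
    slash_action_eq' := by
      rintro _ ⟨γ, rfl⟩
      exact key γ
    holo' := by
      rw [UpperHalfPlane.mdifferentiable_iff]
      refine hol.congr fun z hz => ?_
      simp [ofComplex_apply_of_im_pos hz]
    bdd_at_cusps' := by
      intro c hc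
      rw [OnePoint.isBoundedAt_iff_forall_SL2Z hc]
      intro γ _
      erw [key γ]
      obtain ⟨A, M, h⟩ := hbdd
      exact UpperHalfPlane.isBoundedAtImInfty_iff.mpr ⟨M, A, fun z hz => h z z.im_pos hz⟩ }

/-- A modular form of weight 12 for `SL₂(ℤ)` whose `q`-expansion satisfies
`a_f(0) = 1` and `a_f(1) = 0` equals `E₄³ − 720Δ`; equivalently
`12f = 7E₄³ + 5E₆²`. -/
theorem weight_twelve_uniqueness (f : ℂ → ℂ) (af : ℕ → ℂ)
    (hol : DifferentiableOn ℂ f {τ : ℂ | 0 < τ.im})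
    (hmod : ∀ a b c d : ℤ, a * d - b * c = 1 → ∀ τ : ℂ, 0 < τ.im →
      f (((a : ℂ) * τ + b) / ((c : ℂ) * τ + d)) = ((c : ℂ) * τ + d) ^ 12 * f τ)
    (hbdd : ∃ A M : ℝ, ∀ τ : ℂ, 0 < τ.im → A ≤ τ.im → ‖f τ‖ ≤ M)
    (hexp : ∀ τ : ℂ, 0 < τ.im →
      (Summable fun n : ℕ => af n * qq τ ^ n) ∧ f τ = ∑' n : ℕ, af n * qq τ ^ n)
    (h0 : af 0 = 1) (h1 : af 1 = 0) :
    (∀ τ : ℂ, 0 < τ.im → f τ = E4 τ ^ 3 - 720 * Delta τ) ∧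
    (∀ τ : ℂ, 0 < τ.im → 12 * f τ = 7 * E4 τ ^ 3 + 5 * E6 τ ^ 2) := by
  have main : ∀ τ : ℂ, 0 < τ.im → 12 * f τ = 7 * E4 τ ^ 3 + 5 * E6 τ ^ 2 := by
    let F := mkForm f hol hmod hbdd
    have hF : ∀ z : ℍ, F z = f z := fun z => rfl
    have hco : ∀ m, af m = (qExpansion 1 F).coeff m := by
      refine ModularFormClass.qExpansion_coeff_unique one_pos one_mem_strictPeriods_SL ?_
      intro τ
      obtain ⟨hs, he⟩ := hexp τ τ.im_pos
      rw [hF, he]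
      simpa [qq, Function.Periodic.qParam] using hs.hasSum
    let A : ModularForm 𝒮ℒ 12 := ModularForm.mcast (by decide) (E₄.pow 3)
    let B : ModularForm 𝒮ℒ 12 := ModularForm.mcast (by decide) (E₆.pow 2)
    let G : ModularForm 𝒮ℒ 12 := (12 : ℂ) • F - ((7 : ℂ) • A + (5 : ℂ) • B)
    have hA : qExpansion 1 A = qExpansion 1 E₄ * qExpansion 1 E₄ * qExpansion 1 E₄ := by
      simp only [A, ModularForm.coe_mcast, ModularForm.qExpansion_pow one_pos one_mem_strictPeriods_SL]
      ring
    have hB : qExpansion 1 B = qExpansion 1 E₆ * qExpansion 1 E₆ := by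
      simp only [B, ModularForm.coe_mcast, ModularForm.qExpansion_pow one_pos one_mem_strictPeriods_SL]
      ring
    have hG : qExpansion 1 G = (12 : ℂ) • qExpansion 1 F -
        ((7 : ℂ) • qExpansion 1 A + (5 : ℂ) • qExpansion 1 B) := by
      have e1 : (G : ℍ → ℂ) = ⇑((12 : ℂ) • F) - ⇑((7 : ℂ) • A + (5 : ℂ) • B) := rfl
      have e2 : ⇑((7 : ℂ) • A + (5 : ℂ) • B) = ⇑((7 : ℂ) • A) + ⇑((5 : ℂ) • B) := rfl
      have e3 : ∀ (c : ℂ) (H : ModularForm 𝒮ℒ 12), qExpansion 1 ⇑(c • H) = c • qExpansion 1 H :=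
        fun c H => ModularForm.qExpansion_smul one_pos one_mem_strictPeriods_SL c H
      rw [e1, ModularForm.qExpansion_sub one_pos one_mem_strictPeriods_SL, e2,
        ModularForm.qExpansion_add one_pos one_mem_strictPeriods_SL, e3, e3, e3]
    have hG0 : G = 0 := by
      apply sturm_bound_levelOne
      refine lt_of_lt_of_le (b := (2 : ℕ∞)) (by decide +kernel) ?_
      refine PowerSeries.nat_le_order _ 2 fun i hi => ?_
      rw [hG, hA, hB]
      interval_cases i
      · norm_num [PowerSeries.coeff_mul, Finset.Nat.antidiagonal_succ, ← hco, h0,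
          -PowerSeries.coeff_zero_eq_constantCoeff,
          E_qExpansion_coeff_zero _ ⟨2, rfl⟩, E_qExpansion_coeff_zero _ ⟨3, rfl⟩]
      · norm_num [PowerSeries.coeff_mul, Finset.Nat.antidiagonal_succ, ← hco, h1,
          -PowerSeries.coeff_zero_eq_constantCoeff,
          E₄_qExpansion_coeff_one, E₆_qExpansion_coeff_one,
          E_qExpansion_coeff_zero _ ⟨2, rfl⟩, E_qExpansion_coeff_zero _ ⟨3, rfl⟩]
    intro τ hτ
    have hz : G ⟨τ, hτ⟩ = 0 := by rw [hG0]; rfl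
    have hz' : 12 * f τ - (7 * E₄ ⟨τ, hτ⟩ ^ 3 + 5 * E₆ ⟨τ, hτ⟩ ^ 2) = 0 := by
      rw [← hz]
      simp only [G, A, B, ModularForm.coe_pow, hF, ModularForm.sub_apply, ModularForm.add_apply,
        ModularForm.smul_apply, ModularForm.coe_mcast, Pi.pow_apply, smul_eq_mul]
    have a4 : E4 τ = _ := E4_eq ⟨τ, hτ⟩
    have a6 : E6 τ = _ := E6_eq ⟨τ, hτ⟩
    rw [a4, a6]
    linear_combination hz'
  refine ⟨fun τ hτ => ?_, main⟩
  rw [Delta]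
  linear_combination (main τ hτ) / 12
end
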